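/- arXiv:1612.01123 — 4 statements merged into one kernel-verified Lean document; each statement's English description precedes it below -/
import Mathlib

section
/- Let W : ℝ → ℝ be smooth, nonnegative, and supported in [0,1], and let (λₙ)ₙ₌₁^∞ be a real sequence with λₙ → 0. Then there exists a strictly increasing sequence (Nₙ)ₙ₌₁^∞ of positive reals with Nₙ + 1 < Nₙ₊₁ and Nₙ/Nₙ₊₁ → 0 such that, for the Pearson potential V(x) = Σₙ λₙ W(x − Nₙ), the following holds: writing, for each ξ ∈ ℂ, u(ξ,·) : [0,∞) → ℂ for the Neumann solution of −∂ₓ²u(ξ,x) + V(x)·u(ξ,x) = ξ·u(ξ,x) with u(ξ,0) = 1 and ∂ₓu(ξ,0) = 0, and S_L(ξ,ζ) = ∫₀^L u(ξ,r)·u(ζ,r) dr for the Christoffel–Darboux kernel, one has S_L(ξ + a/L, ξ + b/L)/S_L(ξ,ξ) → sin(π·ρ(ξ)·(b−a))/(π·ρ(ξ)·(b−a)) as L → ∞, uniformly for ξ in compact subsets of (0,∞) and for a, b in compact subsets of the strip {z ∈ ℂ : |Im z| ≤ 1}, where ρ(ξ) = 1/(2π√ξ) and sin(z)/z is interpreted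 as 1 at z = 0. -/
open scoped Real

/-- `sin z / z`, interpreted as `1` at `z = 0`. -/
noncomputable def csinc (z : ℂ) : ℂ := if z = 0 then 1 else Complex.sin z / z

/-- The free density of states `ρ(ξ) = 1/(2π√ξ)`. -/
noncomputable def freeDOS (ξ : ℝ) : ℝ := 1 / (2 * π * Real.sqrt ξ)

theorem gronwall_integral_upper {f f' r t : ℝ → ℝ} {x₀ x₁ : ℝ} (h01 : x₀ ≤ x₁)
    (hf : ContinuousOn f (Set.Icc x₀ x₁))
    (hf' : ∀ x ∈ Set.Ioo x₀ x₁, HasDerivAt f (f' x) x)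
    (hr : Continuous r) (ht : Continuous t) (hr0 : ∀ x, 0 ≤ r x) (ht0 : ∀ x, 0 ≤ t x)
    (hle : ∀ x ∈ Set.Ioo x₀ x₁, f' x ≤ r x * f x + t x) :
    f x₁ ≤ Real.exp (∫ x in x₀..x₁, r x) * (f x₀ + ∫ x in x₀..x₁, t x) := by
  have hRd : ∀ x, HasDerivAt (fun y => ∫ s in x₀..y, r s) (r x) x := fun x =>
    hr.integral_hasStrictDerivAt x₀ x |>.hasDerivAt
  have hTd : ∀ x, HasDerivAt (fun y => ∫ s in x₀..y, t s) (t x) x := fun x =>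
    ht.integral_hasStrictDerivAt x₀ x |>.hasDerivAt
  set R := fun y => ∫ s in x₀..y, r s with hR
  set T := fun y => ∫ s in x₀..y, t s with hT
  have hd : ∀ x ∈ Set.Ioo x₀ x₁, HasDerivAt (fun y => Real.exp (-R y) * f y - T y)
      (Real.exp (-R x) * (-r x) * f x + Real.exp (-R x) * f' x - t x) x := fun x hx =>
    (((hRd x).fun_neg.exp).mul (hf' x hx)).sub (hTd x)
  have hanti : AntitoneOn (fun y => Real.exp (-R y) * f y - T y) (Set.Icc x₀ x₁) := by
    refine antitoneOn_of_deriv_nonpos (convex_Icc _ _) ?_ ?_ ?_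
    · refine ContinuousOn.sub (ContinuousOn.mul (Continuous.continuousOn ?_) hf)
        (Continuous.continuousOn ?_)
      · exact Real.continuous_exp.comp
          (continuous_iff_continuousAt.2 fun x => (hRd x).continuousAt).neg
      · exact continuous_iff_continuousAt.2 fun x => (hTd x).continuousAt
    · intro x hx
      rw [interior_Icc] at hx
      exact (hd x hx).differentiableAt.differentiableWithinAt
    · intro x hx
      rw [interior_Icc] at hx
      rw [(hd x hx).deriv]
      have hR0 : 0 ≤ R x := intervalIntegral.integral_nonneg hx.1.le fun s _ => hr0 s
      have h1 : Real.exp (-R x) ≤ 1 := Real.exp_le_one_iff.2 (by linarith)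
      have h2 := mul_le_mul_of_nonneg_left (hle x hx) (Real.exp_pos (-R x)).le
      have h3 := mul_le_mul_of_nonneg_right h1 (ht0 x)
      nlinarith
  have key := hanti (Set.left_mem_Icc.2 h01) (Set.right_mem_Icc.2 h01) h01
  have hR0 : R x₀ = 0 := intervalIntegral.integral_same
  have hT0 : T x₀ = 0 := intervalIntegral.integral_same
  simp only [hR0, hT0, neg_zero, Real.exp_zero, one_mul, sub_zero] at key
  have h1 := mul_le_mul_of_nonneg_left key (Real.exp_pos (R x₁)).le
  have h2 : Real.exp (R x₁) * Real.exp (-R x₁) = 1 := by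
    rw [← Real.exp_add, add_neg_cancel, Real.exp_zero]
  have h3 : f x₁ = Real.exp (R x₁) * (Real.exp (-R x₁) * f x₁ - T x₁)
      + Real.exp (R x₁) * T x₁ := by
    rw [mul_sub, ← mul_assoc, h2]; ring
  rw [h3, mul_add]
  linarith

theorem gronwall_integral_lower {f f' : ℝ → ℝ} {r x₀ x₁ : ℝ} (h01 : x₀ ≤ x₁)
    (hf : ContinuousOn f (Set.Icc x₀ x₁))
    (hf' : ∀ x ∈ Set.Ioo x₀ x₁, HasDerivAt f (f' x) x)
    (hle : ∀ x ∈ Set.Ioo x₀ x₁, -(r * f x) ≤ f' x) :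
    f x₀ ≤ Real.exp (r * (x₁ - x₀)) * f x₁ := by
  have hd : ∀ x ∈ Set.Ioo x₀ x₁, HasDerivAt (fun y => Real.exp (r * (y - x₀)) * f y)
      (Real.exp (r * (x - x₀)) * (r * 1) * f x + Real.exp (r * (x - x₀)) * f' x) x :=
    fun x hx => ((((hasDerivAt_id x).sub_const x₀).const_mul r).exp).mul (hf' x hx)
  have hmono : MonotoneOn (fun y => Real.exp (r * (y - x₀)) * f y) (Set.Icc x₀ x₁) := by
    refine monotoneOn_of_deriv_nonneg (convex_Icc _ _) ?_ ?_ ?_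
    · exact ContinuousOn.mul (Continuous.continuousOn (by fun_prop)) hf
    · intro x hx
      rw [interior_Icc] at hx
      exact (hd x hx).differentiableAt.differentiableWithinAt
    · intro x hx
      rw [interior_Icc] at hx
      rw [(hd x hx).deriv]
      have h2 := mul_le_mul_of_nonneg_left (hle x hx) (Real.exp_pos (r * (x - x₀))).le
      nlinarith
  have key := hmono (Set.left_mem_Icc.2 h01) (Set.right_mem_Icc.2 h01) h01
  simpa using key

/-- The energy `|d'|² + k²|d|²` of a function `d` with derivative `d'`. -/
noncomputable def oscEnergy (k : ℝ) (d d' : ℝ → ℂ) (x : ℝ) : ℝ :=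
  ‖d' x‖ ^ 2 + k ^ 2 * ‖d x‖ ^ 2

theorem oscEnergy_nonneg (k : ℝ) (d d' : ℝ → ℂ) (x : ℝ) : 0 ≤ oscEnergy k d d' x := by
  unfold oscEnergy; positivity

theorem oscEnergy_hasDerivAt {d d' d'' : ℝ → ℂ} (k : ℝ) {x : ℝ}
    (hd : HasDerivAt d (d' x) x) (hd' : HasDerivAt d' (d'' x) x) :
    HasDerivAt (oscEnergy k d d') (2 * inner ℝ (d' x) (d'' x + (k : ℂ) ^ 2 * d x)) x := by
  have h := hd'.norm_sq.add (hd.norm_sq.const_mul (k ^ 2))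
  refine h.congr_deriv ?_
  have : (k : ℂ) ^ 2 * d x = (k ^ 2) • d x := by simp
  rw [this, inner_add_right, inner_smul_right, real_inner_comm (d x) (d' x)]
  ring

theorem oscEnergy_continuousOn {d d' d'' : ℝ → ℂ} (k : ℝ) {x₀ x₁ : ℝ} (h0 : 0 ≤ x₀)
    (hd : ∀ x ∈ Set.Ici (0 : ℝ), HasDerivWithinAt d (d' x) (Set.Ici 0) x)
    (hd' : ∀ x ∈ Set.Ici (0 : ℝ), HasDerivWithinAt d' (d'' x) (Set.Ici 0) x) :
    ContinuousOn (oscEnergy k d d') (Set.Icc x₀ x₁) := by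
  have hsub : Set.Icc x₀ x₁ ⊆ Set.Ici 0 := fun x hx => h0.trans hx.1
  have h1 : ContinuousOn d (Set.Icc x₀ x₁) :=
    ContinuousOn.mono (fun x hx => (hd x hx).continuousWithinAt) hsub
  have h2 : ContinuousOn d' (Set.Icc x₀ x₁) :=
    ContinuousOn.mono (fun x hx => (hd' x hx).continuousWithinAt) hsub
  exact (h2.norm.pow 2).add (continuousOn_const.mul (h1.norm.pow 2))

theorem oscEnergy_upper {d d' d'' : ℝ → ℂ} {p q : ℝ → ℝ} {k x₀ x₁ P s : ℝ} (hk : 0 < k)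
    (h0 : 0 ≤ x₀) (h01 : x₀ ≤ x₁)
    (hd : ∀ x ∈ Set.Ici (0 : ℝ), HasDerivWithinAt d (d' x) (Set.Ici 0) x)
    (hd' : ∀ x ∈ Set.Ici (0 : ℝ), HasDerivWithinAt d' (d'' x) (Set.Ici 0) x)
    (hp : Continuous p) (hq : Continuous q) (hp0 : ∀ x, 0 ≤ p x) (hq0 : ∀ x, 0 ≤ q x)
    (hle : ∀ x ∈ Set.Icc x₀ x₁, ‖d'' x + (k : ℂ) ^ 2 * d x‖ ≤ p x * ‖d x‖ + q x)
    (hP : ∫ x in x₀..x₁, p x ≤ k * P) (hQ : ∫ x in x₀..x₁, q x ≤ s) (hs : 0 < s) :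
    oscEnergy k d d' x₁ ≤ Real.exp (P + 1) * (oscEnergy k d d' x₀ + s ^ 2) := by
  have hmem : ∀ x ∈ Set.Ioo x₀ x₁, 0 < x := fun x hx => h0.trans_lt hx.1
  have key := gronwall_integral_upper (r := fun x => p x / k + q x / s) (t := fun x => q x * s)
    h01 (oscEnergy_continuousOn k h0 hd hd')
    (fun x hx => oscEnergy_hasDerivAt k
      ((hd x (hmem x hx).le).hasDerivAt (Ici_mem_nhds (hmem x hx)))
      ((hd' x (hmem x hx).le).hasDerivAt (Ici_mem_nhds (hmem x hx))))
    (by fun_prop) (by fun_prop)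
    (fun x => add_nonneg (div_nonneg (hp0 x) hk.le) (div_nonneg (hq0 x) hs.le))
    (fun x => mul_nonneg (hq0 x) hs.le) ?_
  · refine key.trans ?_
    have h1 : ∫ x in x₀..x₁, (p x / k + q x / s) ≤ P + 1 := by
      rw [intervalIntegral.integral_add ((hp.div_const k).intervalIntegrable _ _)
        ((hq.div_const s).intervalIntegrable _ _), intervalIntegral.integral_div,
        intervalIntegral.integral_div]
      gcongr
      · rw [div_le_iff₀ hk]; linarith
      · rw [div_le_one hs]; exact hQ
    have h2 : ∫ x in x₀..x₁, q x * s ≤ s ^ 2 := by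
      rw [intervalIntegral.integral_mul_const]; nlinarith
    have h3 : 0 ≤ ∫ x in x₀..x₁, q x * s :=
      intervalIntegral.integral_nonneg h01 fun x _ => mul_nonneg (hq0 x) hs.le
    have := oscEnergy_nonneg k d d' x₀
    gcongr
  · intro x hx
    have h1 := hle x (Set.Ioo_subset_Icc_self hx)
    have h2 := real_inner_le_norm (d' x) (d'' x + (k : ℂ) ^ 2 * d x)
    have h3 := mul_le_mul_of_nonneg_left h1 (norm_nonneg (d' x))
    have hE : 2 * (‖d' x‖ * ‖d x‖) ≤ oscEnergy k d d' x / k := by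
      rw [le_div_iff₀ hk]; unfold oscEnergy
      nlinarith [sq_nonneg (‖d' x‖ - k * ‖d x‖)]
    have hF : 2 * ‖d' x‖ ≤ oscEnergy k d d' x / s + s := by
      rw [← sub_le_iff_le_add, le_div_iff₀ hs]; unfold oscEnergy
      nlinarith [sq_nonneg (‖d' x‖ - s), mul_nonneg (sq_nonneg k) (sq_nonneg ‖d x‖)]
    have h4 := mul_le_mul_of_nonneg_left hE (hp0 x)
    have h5 := mul_le_mul_of_nonneg_left hF (hq0 x)
    have h6 : (p x / k + q x / s) * oscEnergy k d d' x + q x * s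
      = p x * (oscEnergy k d d' x / k) + q x * (oscEnergy k d d' x / s + s) := by ring
    rw [h6]
    nlinarith

theorem oscEnergy_lower {d d' d'' : ℝ → ℂ} {k x₀ x₁ p : ℝ} (hk : 0 < k)
    (h0 : 0 ≤ x₀) (h01 : x₀ ≤ x₁)
    (hd : ∀ x ∈ Set.Ici (0 : ℝ), HasDerivWithinAt d (d' x) (Set.Ici 0) x)
    (hd' : ∀ x ∈ Set.Ici (0 : ℝ), HasDerivWithinAt d' (d'' x) (Set.Ici 0) x) (hp : 0 ≤ p)
    (hle : ∀ x ∈ Set.Icc x₀ x₁, ‖d'' x + (k : ℂ) ^ 2 * d x‖ ≤ p * ‖d x‖) :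
    oscEnergy k d d' x₀ ≤ Real.exp (p / k * (x₁ - x₀)) * oscEnergy k d d' x₁ := by
  have hmem : ∀ x ∈ Set.Ioo x₀ x₁, 0 < x := fun x hx => h0.trans_lt hx.1
  refine gronwall_integral_lower h01 (oscEnergy_continuousOn k h0 hd hd')
    (fun x hx => oscEnergy_hasDerivAt k
      ((hd x (hmem x hx).le).hasDerivAt (Ici_mem_nhds (hmem x hx)))
      ((hd' x (hmem x hx).le).hasDerivAt (Ici_mem_nhds (hmem x hx)))) ?_
  intro x hx
  have h1 := hle x (Set.Ioo_subset_Icc_self hx)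
  have h2 := neg_le_of_abs_le (abs_real_inner_le_norm (d' x) (d'' x + (k : ℂ) ^ 2 * d x))
  have h3 := mul_le_mul_of_nonneg_left h1 (norm_nonneg (d' x))
  have hE : 2 * (‖d' x‖ * ‖d x‖) ≤ oscEnergy k d d' x / k := by
    rw [le_div_iff₀ hk]; unfold oscEnergy
    nlinarith [sq_nonneg (‖d' x‖ - k * ‖d x‖)]
  have h4 := mul_le_mul_of_nonneg_left hE hp
  have h6 : p / k * oscEnergy k d d' x = p * (oscEnergy k d d' x / k) := by ring
  rw [h6]
  nlinarith

/-- `u` solves `-u'' + V u = z u` on `[0, ∞)` with Neumann data `u(0) = 1`, `u'(0) = 0`. -/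
structure IsNeumannSol (V : ℝ → ℝ) (z : ℂ) (u u' : ℝ → ℂ) : Prop where
  hasDeriv : ∀ x ∈ Set.Ici (0 : ℝ), HasDerivWithinAt u (u' x) (Set.Ici 0) x
  hasDeriv' : ∀ x ∈ Set.Ici (0 : ℝ),
    HasDerivWithinAt u' (((V x : ℂ) - z) * u x) (Set.Ici 0) x
  val : u 0 = 1
  val' : u' 0 = 0

namespace IsNeumannSol

variable {V : ℝ → ℝ} {z z₁ z₂ : ℂ} {u u' u₁ u₁' u₂ u₂' : ℝ → ℂ} {κ k A B M τ : ℝ}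

theorem conj (h : IsNeumannSol V z u u') :
    IsNeumannSol V (starRingEnd ℂ z) (fun x => starRingEnd ℂ (u x))
      (fun x => starRingEnd ℂ (u' x)) where
  hasDeriv x hx := (h.hasDeriv x hx).star
  hasDeriv' x hx := by
    have := (h.hasDeriv' x hx).star
    refine this.congr_deriv ?_
    simp
  val := by simp [h.val]
  val' := by simp [h.val']

theorem continuousOn (h : IsNeumannSol V z u u') : ContinuousOn u (Set.Ici 0) :=
  fun x hx => (h.hasDeriv x hx).continuousWithinAt

theorem norm_potential_le (hV : ∀ x, |V x| ≤ B) (hz : ‖z - (k : ℂ) ^ 2‖ ≤ A) (x : ℝ) :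
    ‖(V x : ℂ) - (z - (k : ℂ) ^ 2)‖ ≤ B + A :=
  (norm_sub_le _ _).trans (add_le_add (by simpa using hV x) hz)

theorem sq_norm_le (h : IsNeumannSol V z u u') (hκ : 0 < κ) (hk : κ ≤ k)
    (hV : ∀ x, |V x| ≤ B) (hz : ‖z - (k : ℂ) ^ 2‖ ≤ A) {x : ℝ} (hx : x ∈ Set.Icc 0 M) :
    ‖u x‖ ^ 2 ≤ 2 * Real.exp ((B + A) / κ * M + 1) := by
  have hk0 : 0 < k := hκ.trans_le hk
  have hB : 0 ≤ B := (abs_nonneg _).trans (hV 0)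
  have hA : 0 ≤ A := (norm_nonneg _).trans hz
  have key := oscEnergy_upper (p := fun _ => B + A) (q := fun _ => 0) (s := k)
    (P := (B + A) / κ * M) hk0 le_rfl hx.1 h.hasDeriv h.hasDeriv' continuous_const
    continuous_const (fun _ => by positivity) (fun _ => le_rfl) (fun y _ => ?_) ?_ ?_ hk0
  · have h0 : oscEnergy k u u' 0 = k ^ 2 := by simp [oscEnergy, h.val, h.val']
    rw [h0] at key
    have h1 : k ^ 2 * ‖u x‖ ^ 2 ≤ oscEnergy k u u' x := by
      unfold oscEnergy; nlinarith [sq_nonneg ‖u' x‖]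
    have h2 : k ^ 2 * ‖u x‖ ^ 2 ≤ k ^ 2 * (2 * Real.exp ((B + A) / κ * M + 1)) := by
      linarith
    exact le_of_mul_le_mul_left h2 (by positivity)
  · have : ((V y : ℂ) - z) * u y + (k : ℂ) ^ 2 * u y = ((V y : ℂ) - (z - (k : ℂ) ^ 2)) * u y := by
      ring
    rw [this, norm_mul, add_zero]
    gcongr
    exact norm_potential_le hV hz y
  · simp only [intervalIntegral.integral_const, smul_eq_mul, sub_zero]
    have h1 : k * ((B + A) / κ * M) = (B + A) * M * (k / κ) := by ring
    have h2 : 1 ≤ k / κ := (one_le_div hκ).2 hk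
    rw [h1]
    have hM : 0 ≤ M := hx.1.trans hx.2
    have h3 : (B + A) * x ≤ (B + A) * M := by gcongr; exact hx.2
    have h4 : 0 ≤ (B + A) * M := by positivity
    nlinarith
  · simpa using hk0.le

theorem one_le_exp_mul (h : IsNeumannSol V ((k : ℂ) ^ 2) u u') (hκ : 0 < κ) (hk : κ ≤ k)
    (hV : ∀ x, |V x| ≤ B) (hM : 0 ≤ M) :
    1 ≤ Real.exp (B / κ * M) * (oscEnergy k u u' M / k ^ 2) := by
  have hk0 : 0 < k := hκ.trans_le hk
  have hB : 0 ≤ B := (abs_nonneg _).trans (hV 0)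
  have key := oscEnergy_lower (p := B) hk0 le_rfl hM h.hasDeriv h.hasDeriv' hB (fun y _ => ?_)
  · have h0 : oscEnergy k u u' 0 = k ^ 2 := by simp [oscEnergy, h.val, h.val']
    rw [h0, sub_zero] at key
    rw [← mul_div_assoc, one_le_div (by positivity)]
    refine key.trans ?_
    have := oscEnergy_nonneg k u u' M
    gcongr
  · have : ((V y : ℂ) - (k : ℂ) ^ 2) * u y + (k : ℂ) ^ 2 * u y = V y * u y := by ring
    rw [this, norm_mul]
    gcongr
    simpa using hV y

theorem oscEnergy_sub_le (h₁ : IsNeumannSol V z₁ u₁ u₁') (h₂ : IsNeumannSol V z₂ u₂ u₂')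
    (hκ : 0 < κ) (hk : κ ≤ k) (hV : ∀ x, |V x| ≤ B) (hz₁ : ‖z₁ - (k : ℂ) ^ 2‖ ≤ A)
    (hz₂ : ‖z₂ - (k : ℂ) ^ 2‖ ≤ A) (hM : 0 ≤ M) (hτ : 0 < τ) (hz : ‖z₁ - z₂‖ ≤ τ) :
    oscEnergy k (fun x => u₁ x - u₂ x) (fun x => u₁' x - u₂' x) M ≤
      2 * Real.exp ((B + A) / κ * M + 1) ^ 2 * ((M + 1) * τ) ^ 2 := by
  have hk0 : 0 < k := hκ.trans_le hk
  have hB : 0 ≤ B := (abs_nonneg _).trans (hV 0)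
  have hA : 0 ≤ A := (norm_nonneg _).trans hz₁
  set D := Real.exp ((B + A) / κ * M + 1) with hD
  have hD0 : 0 < D := Real.exp_pos _
  have key := oscEnergy_upper (p := fun _ => B + A) (q := fun _ => τ * √(2 * D))
    (s := (M + 1) * τ * √(2 * D)) (P := (B + A) / κ * M) hk0 le_rfl hM
    (fun x hx => (h₁.hasDeriv x hx).sub (h₂.hasDeriv x hx))
    (fun x hx => (h₁.hasDeriv' x hx).sub (h₂.hasDeriv' x hx)) continuous_const
    continuous_const (fun _ => by positivity) (fun _ => by positivity) (fun y hy => ?_) ?_ ?_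
    (by positivity)
  · have h0 : oscEnergy k (fun x => u₁ x - u₂ x) (fun x => u₁' x - u₂' x) 0 = 0 := by
      simp [oscEnergy, h₁.val, h₁.val', h₂.val, h₂.val']
    have hs : √(2 * D) ^ 2 = 2 * D := Real.sq_sqrt (by positivity)
    change _ ≤ D * (oscEnergy k (fun x => u₁ x - u₂ x) (fun x => u₁' x - u₂' x) 0 + _) at key
    rw [h0, mul_pow, hs] at key
    change oscEnergy k (fun x => u₁ x - u₂ x) (fun x => u₁' x - u₂' x) M ≤ _ at key
    linarith
  · have : ((V y : ℂ) - z₁) * u₁ y - ((V y : ℂ) - z₂) * u₂ y + (k : ℂ) ^ 2 * (u₁ y - u₂ y)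
        = ((V y : ℂ) - (z₁ - (k : ℂ) ^ 2)) * (u₁ y - u₂ y) - (z₁ - z₂) * u₂ y := by ring
    simp only [Pi.sub_apply]
    rw [this]
    refine (norm_sub_le _ _).trans ?_
    rw [norm_mul, norm_mul]
    gcongr
    · exact norm_potential_le hV hz₁ y
    · exact Real.le_sqrt_of_sq_le (h₂.sq_norm_le hκ hk hV hz₂ hy)
  · simp only [intervalIntegral.integral_const, smul_eq_mul, sub_zero]
    have h1 : k * ((B + A) / κ * M) = (B + A) * M * (k / κ) := by ring
    have h2 : 1 ≤ k / κ := (one_le_div hκ).2 hk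
    rw [h1]
    have h4 : 0 ≤ (B + A) * M := by positivity
    nlinarith
  · simp only [intervalIntegral.integral_const, smul_eq_mul, sub_zero]
    have : 0 ≤ τ * √(2 * D) := by positivity
    nlinarith

theorem conj_eq (h : IsNeumannSol V ((k : ℂ) ^ 2) u u') (hk : 0 < k)
    (hV : ∀ x, |V x| ≤ B) (hM : 0 ≤ M) :
    starRingEnd ℂ (u M) = u M ∧ starRingEnd ℂ (u' M) = u' M := by
  have hz : starRingEnd ℂ ((k : ℂ) ^ 2) = (k : ℂ) ^ 2 := by simp
  have hc := h.conj
  rw [hz] at hc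
  have key : ∀ τ : ℝ, 0 < τ → _ := fun τ hτ => hc.oscEnergy_sub_le h hk le_rfl hV
    (A := 0) (by simp) (by simp) hM hτ (by simpa using hτ.le)
  have hlim : Filter.Tendsto
      (fun τ : ℝ => 2 * Real.exp ((B + 0) / k * M + 1) ^ 2 * ((M + 1) * τ) ^ 2)
      (nhdsWithin 0 (Set.Ioi 0)) (nhds 0) := by
    refine Filter.Tendsto.mono_left ?_ nhdsWithin_le_nhds
    refine Continuous.tendsto' (by fun_prop) _ _ (by simp)
  have h0 := ge_of_tendsto hlim (Filter.eventually_of_mem self_mem_nhdsWithin key)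
  unfold oscEnergy at h0
  have h1 : 0 ≤ k ^ 2 * ‖starRingEnd ℂ (u M) - u M‖ ^ 2 := by positivity
  have h2 : 0 ≤ ‖starRingEnd ℂ (u' M) - u' M‖ ^ 2 := by positivity
  constructor
  · have h3 : k ^ 2 * ‖starRingEnd ℂ (u M) - u M‖ ^ 2 = 0 := by linarith
    have : k ^ 2 ≠ 0 := by positivity
    simpa [this, hk.ne', sub_eq_zero] using h3
  · have h3 : ‖starRingEnd ℂ (u' M) - u' M‖ ^ 2 = 0 := by linarith
    simpa [sub_eq_zero] using h3

theorem exists_phase (h : IsNeumannSol V ((k : ℂ) ^ 2) u u') (hk : 0 < k)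
    (hV : ∀ x, |V x| ≤ B) (hM : 0 ≤ M) :
    ∃ R φ : ℝ, 0 ≤ R ∧ R ^ 2 = oscEnergy k u u' M / k ^ 2 ∧
      u M = R * Complex.cos φ ∧ u' M = -(R * k * Complex.sin φ) := by
  obtain ⟨h1, h2⟩ := h.conj_eq hk hV hM
  obtain ⟨F, hF⟩ := Complex.conj_eq_iff_real.1 h1
  obtain ⟨G, hG⟩ := Complex.conj_eq_iff_real.1 h2
  have hkC : (k : ℂ) ≠ 0 := by exact_mod_cast hk.ne'
  refine ⟨‖(⟨F, -G / k⟩ : ℂ)‖, Complex.arg ⟨F, -G / k⟩, norm_nonneg _, ?_, ?_, ?_⟩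
  · rw [Complex.sq_norm, Complex.normSq_apply, oscEnergy, hF, hG, Complex.norm_real,
      Complex.norm_real, Real.norm_eq_abs, Real.norm_eq_abs, sq_abs, sq_abs]
    field_simp
    ring
  · rw [← Complex.ofReal_cos, ← Complex.ofReal_mul, Complex.norm_mul_cos_arg, hF]
  · rw [mul_right_comm, ← Complex.ofReal_sin, ← Complex.ofReal_mul, Complex.norm_mul_sin_arg, hG]
    push_cast
    field_simp

end IsNeumannSol

theorem norm_cos_le_exp_abs_im (z : ℂ) : ‖Complex.cos z‖ ≤ Real.exp |z.im| := by
  rw [Complex.cos, norm_div, Complex.norm_ofNat, div_le_iff₀ two_pos]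
  refine (norm_add_le _ _).trans ?_
  rw [Complex.norm_exp, Complex.norm_exp]
  have h1 : (z * Complex.I).re ≤ |z.im| := by simpa using neg_le_abs z.im
  have h2 : (-z * Complex.I).re ≤ |z.im| := by simpa using le_abs_self z.im
  have := Real.exp_le_exp.2 h1
  have := Real.exp_le_exp.2 h2
  linarith

theorem norm_sin_le_exp_abs_im (z : ℂ) : ‖Complex.sin z‖ ≤ Real.exp |z.im| := by
  have h := norm_cos_le_exp_abs_im (Real.pi / 2 - z)
  have him : ((Real.pi : ℂ) / 2 - z).im = -z.im := by
    have : ((Real.pi : ℂ) / 2) = ((Real.pi / 2 : ℝ) : ℂ) := by push_cast; ring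
    rw [this, Complex.sub_im, Complex.ofReal_im, zero_sub]
  rwa [Complex.cos_pi_div_two_sub, him, abs_neg] at h

theorem abs_im_phase_le {κ k A L t φ : ℝ} {a : ℂ} (hκ : 0 < κ) (hk : κ ≤ k) (hL : 0 < L)
    (ha : ‖a‖ ≤ A) (ht0 : 0 ≤ t) (ht : t ≤ L) :
    |(((k : ℂ) + a / (2 * k * L)) * t + φ).im| ≤ A / (2 * κ) := by
  have hk0 : 0 < k := hκ.trans_le hk
  have h1 : ((k : ℂ) + a / (2 * k * L)) * t + φ
      = ((k * t + φ : ℝ) : ℂ) + ((t / (2 * k * L) : ℝ) : ℂ) * a := by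
    push_cast; ring
  have hA : 0 ≤ A := (norm_nonneg _).trans ha
  rw [h1, Complex.add_im, Complex.ofReal_im, zero_add, Complex.im_ofReal_mul, abs_mul,
    abs_of_nonneg (by positivity)]
  have h2 : |a.im| ≤ A := (Complex.abs_im_le_norm a).trans ha
  calc t / (2 * k * L) * |a.im| ≤ L / (2 * κ * L) * A := by gcongr
    _ = A / (2 * κ) := by field_simp

theorem hasDerivAt_cos_phase (R : ℝ) (w : ℂ) (M φ x : ℝ) :
    HasDerivAt (fun y : ℝ => R * Complex.cos (w * ((y - M : ℝ) : ℂ) + φ))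
      (-(R * w * Complex.sin (w * ((x - M : ℝ) : ℂ) + φ))) x := by
  have h1 : HasDerivAt (fun y : ℝ => w * ((y - M : ℝ) : ℂ) + φ) (w * 1) x :=
    ((((hasDerivAt_id x).sub_const M).ofReal_comp).const_mul w).add_const _
  refine (((Complex.hasDerivAt_cos _).comp x h1).const_mul (R : ℂ)).congr_deriv ?_
  ring

theorem hasDerivAt_sin_phase (R : ℝ) (w : ℂ) (M φ x : ℝ) :
    HasDerivAt (fun y : ℝ => -(R * w * Complex.sin (w * ((y - M : ℝ) : ℂ) + φ)))
      (-(w ^ 2 * (R * Complex.cos (w * ((x - M : ℝ) : ℂ) + φ)))) x := by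
  have h1 : HasDerivAt (fun y : ℝ => w * ((y - M : ℝ) : ℂ) + φ) (w * 1) x :=
    ((((hasDerivAt_id x).sub_const M).ofReal_comp).const_mul w).add_const _
  refine (((Complex.hasDerivAt_sin _).comp x h1).const_mul ((R : ℂ) * w)).fun_neg.congr_deriv ?_
  ring

namespace IsNeumannSol

set_option maxHeartbeats 800000 in
theorem oscEnergy_sub_cos_le {V : ℝ → ℝ} {u₀ u₀' u u' : ℝ → ℂ} {κ k A B M L δ R φ : ℝ} {a : ℂ}
    (h₀ : IsNeumannSol V ((k : ℂ) ^ 2) u₀ u₀') (h : IsNeumannSol V ((k : ℂ) ^ 2 + a / L) u u')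
    (hκ : 0 < κ) (hk : κ ≤ k) (hA : 1 ≤ A) (hVc : Continuous V) (hV : ∀ x, |V x| ≤ B)
    (hM : 0 ≤ M) (hML : M ≤ L) (hL : 1 ≤ L) (hδ1 : δ ≤ 1) (hδ : ∫ x in M..L, |V x| ≤ δ)
    (hR : 0 < R) (hRu : u₀ M = R * Complex.cos φ) (hRu' : u₀' M = -(R * k * Complex.sin φ))
    (hRD : 1 ≤ Real.exp ((B + A) / κ * M + 1) * R ^ 2)
    (ha : ‖a‖ ≤ A) {x : ℝ} (hx : x ∈ Set.Icc M L) :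
    oscEnergy k
      (fun x => u x - R * Complex.cos ((k + a / (2 * k * L)) * ((x - M : ℝ) : ℂ) + φ))
      (fun x => u' x - -(R * (k + a / (2 * k * L)) *
        Complex.sin ((k + a / (2 * k * L)) * ((x - M : ℝ) : ℂ) + φ))) x ≤
      Real.exp ((1 + A) / κ + 1) *
        ((2 * Real.exp ((B + A) / κ * M + 1) ^ 2 * (M + 1) * A + A / κ) / L * R) ^ 2 +
      Real.exp ((1 + A) / κ + 1) *
        ((δ + (A ^ 2 / (4 * κ ^ 2) + 1) / L) * (Real.exp (A / (2 * κ)) * R)) ^ 2 := by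
  have hk0 : 0 < k := hκ.trans_le hk
  have hkC : (k : ℂ) ≠ 0 := by exact_mod_cast hk0.ne'
  have hL0 : 0 < L := by linarith
  have hLC : (L : ℂ) ≠ 0 := by exact_mod_cast hL0.ne'
  have hB : 0 ≤ B := (abs_nonneg _).trans (hV 0)
  have hA0 : 0 < A := by linarith
  set D := Real.exp ((B + A) / κ * M + 1) with hD
  have hD1 : 1 ≤ D := Real.one_le_exp (by positivity)
  set C₁ := Real.exp (A / (2 * κ)) with hC₁
  have hC₁0 : 0 < C₁ := Real.exp_pos _
  set w : ℂ := k + a / (2 * k * L) with hw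
  have haL : ‖a / (L : ℂ)‖ ≤ A / L := by
    rw [norm_div, Complex.norm_real, Real.norm_of_nonneg hL0.le]; gcongr
  have haA : A / L ≤ A := div_le_self hA0.le hL
  have hδ0 : 0 ≤ δ := (intervalIntegral.integral_nonneg hML fun _ _ => abs_nonneg _).trans hδ
  have hint : ∫ y in M..x, |V y| ≤ δ :=
    (intervalIntegral.integral_mono_interval le_rfl hx.1 hx.2
      (Filter.Eventually.of_forall fun _ => abs_nonneg _)
      (hVc.abs.intervalIntegrable _ _)).trans hδ
  have hs : 0 < (δ + (A ^ 2 / (4 * κ ^ 2) + 1) / L) * (C₁ * R) := by positivity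
  have hw2 : w ^ 2 - (k : ℂ) ^ 2 - a / L = a ^ 2 / (4 * k ^ 2 * L ^ 2) := by
    rw [hw]; field_simp; ring
  have hw2n : ‖w ^ 2 - (k : ℂ) ^ 2 - a / L‖ ≤ A ^ 2 / (4 * κ ^ 2 * L ^ 2) := by
    rw [hw2, norm_div, norm_mul, norm_mul, norm_pow, norm_pow, norm_pow, Complex.norm_real,
      Complex.norm_real, Real.norm_of_nonneg hL0.le, Real.norm_of_nonneg hk0.le,
      Complex.norm_ofNat]
    gcongr
  have key := oscEnergy_upper (p := fun y => |V y| + A / L)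
    (q := fun y => (|V y| + A ^ 2 / (4 * κ ^ 2 * L ^ 2)) * (C₁ * R))
    (P := (1 + A) / κ) (k := k) (x₀ := M) (x₁ := x)
    (s := (δ + (A ^ 2 / (4 * κ ^ 2) + 1) / L) * (C₁ * R)) hk0 hM hx.1
    (fun y hy => (h.hasDeriv y hy).fun_sub (hasDerivAt_cos_phase R w M φ y).hasDerivWithinAt)
    (fun y hy => (h.hasDeriv' y hy).fun_sub (hasDerivAt_sin_phase R w M φ y).hasDerivWithinAt)
    (by fun_prop) (by fun_prop) (fun _ => by positivity) (fun _ => by positivity)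
    (fun y hy => ?_) ?_ ?_ hs
  · refine key.trans ?_
    rw [mul_add]
    gcongr
    have hd := h.oscEnergy_sub_le h₀ (τ := A / L) hκ hk hV (A := A) (by simpa using haL.trans haA)
      (by simpa using hA0.le) hM (by positivity) (by simpa using haL)
    have hmul : oscEnergy k (fun x => u x - u₀ x) (fun x => u' x - u₀' x) M ≤
        2 * D ^ 2 * ((M + 1) * (A / L)) ^ 2 * (D * R ^ 2) :=
      hd.trans (le_mul_of_one_le_right (by positivity) hRD)
    have hwk : ‖w - k‖ ≤ A / (2 * κ * L) := by
      rw [hw, add_sub_cancel_left, norm_div, norm_mul, norm_mul, Complex.norm_real,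
        Complex.norm_real, Real.norm_of_nonneg hL0.le, Real.norm_of_nonneg hk0.le,
        Complex.norm_ofNat]
      gcongr
    have hsin : ‖Complex.sin (φ : ℂ)‖ ≤ 1 := by
      simpa using norm_sin_le_exp_abs_im (φ : ℂ)
    have hcor : ‖(R : ℂ) * (w - k) * Complex.sin φ‖ ≤ R * (A / (2 * κ * L)) := by
      rw [norm_mul, norm_mul, Complex.norm_real, Real.norm_of_nonneg hR.le]
      have h0 : 0 ≤ A / (2 * κ * L) := by positivity
      have h1 : ‖w - k‖ * ‖Complex.sin (φ : ℂ)‖ ≤ A / (2 * κ * L) * 1 := by gcongr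
      nlinarith
    have hE : oscEnergy k (fun x => u x - R * Complex.cos (w * ((x - M : ℝ) : ℂ) + φ))
        (fun x => u' x - -(R * w * Complex.sin (w * ((x - M : ℝ) : ℂ) + φ))) M ≤
        2 * oscEnergy k (fun x => u x - u₀ x) (fun x => u' x - u₀' x) M +
          2 * (R * (A / (2 * κ * L))) ^ 2 := by
      have e1 : u M - R * Complex.cos (w * ((M - M : ℝ) : ℂ) + φ) = u M - u₀ M := by
        rw [hRu]; simp
      have e2 : u' M - -(R * w * Complex.sin (w * ((M - M : ℝ) : ℂ) + φ)) =
          (u' M - u₀' M) + R * (w - k) * Complex.sin φ := by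
        rw [hRu', sub_self, Complex.ofReal_zero, mul_zero, zero_add]; ring
      simp only [oscEnergy]
      rw [e1, e2]
      have h1 := norm_add_le (u' M - u₀' M) (R * (w - k) * Complex.sin φ)
      have h2 : ‖(u' M - u₀' M) + R * (w - k) * Complex.sin φ‖ ^ 2 ≤
          (‖u' M - u₀' M‖ + R * (A / (2 * κ * L))) ^ 2 := by
        gcongr; exact h1.trans (by gcongr)
      have h3 : 0 ≤ k ^ 2 * ‖u M - u₀ M‖ ^ 2 := by positivity
      have h4 := h2.trans add_sq_le
      rw [mul_add] at h4
      linarith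
    refine hE.trans ?_
    have hD34 : D ^ 2 * D ≤ D ^ 4 := by
      calc D ^ 2 * D = D ^ 3 := by ring
        _ ≤ D ^ 4 := pow_le_pow_right₀ hD1 (by norm_num)
    have hX : 2 * D ^ 2 * ((M + 1) * (A / L)) ^ 2 * (D * R ^ 2) ≤
        2 * D ^ 4 * ((M + 1) * (A / L) * R) ^ 2 := by
      calc _ = D ^ 2 * D * (2 * ((M + 1) * (A / L) * R) ^ 2) := by ring
        _ ≤ D ^ 4 * (2 * ((M + 1) * (A / L) * R) ^ 2) := by gcongr
        _ = _ := by ring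
    have hY : ((2 * D ^ 2 * (M + 1) * A + A / κ) / L * R) ^ 2 =
        4 * D ^ 4 * ((M + 1) * (A / L) * R) ^ 2 + 4 * (R * (A / (2 * κ * L))) ^ 2 +
        8 * D ^ 2 * ((M + 1) * (A / L) * R) * (R * (A / (2 * κ * L))) := by
      field_simp; ring
    have hZ : 0 ≤ 8 * D ^ 2 * ((M + 1) * (A / L) * R) * (R * (A / (2 * κ * L))) := by positivity
    rw [hY]
    have hW : 0 ≤ (R * (A / (2 * κ * L))) ^ 2 := sq_nonneg _
    linarith
  · have hyL : 0 ≤ y - M ∧ y - M ≤ L := ⟨by linarith [hy.1], by linarith [hy.2, hx.2]⟩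
    set c := (R : ℂ) * Complex.cos (w * ((y - M : ℝ) : ℂ) + φ) with hc
    have hcn : ‖c‖ ≤ C₁ * R := by
      rw [hc, norm_mul, Complex.norm_real, Real.norm_of_nonneg hR.le, mul_comm]
      gcongr
      refine (norm_cos_le_exp_abs_im _).trans (Real.exp_le_exp.2 ?_)
      exact abs_im_phase_le hκ hk hL0 ha hyL.1 hyL.2
    have e : ((V y : ℂ) - (k ^ 2 + a / L)) * u y - -(w ^ 2 * c) + (k : ℂ) ^ 2 * (u y - c) =
        (V y - a / L) * (u y - c) + (V y + (w ^ 2 - (k : ℂ) ^ 2 - a / L)) * c := by ring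
    change ‖((V y : ℂ) - (k ^ 2 + a / L)) * u y - -(w ^ 2 * c) + (k : ℂ) ^ 2 * (u y - c)‖ ≤
      (|V y| + A / L) * ‖u y - c‖ + _
    rw [e]
    refine (norm_add_le _ _).trans ?_
    rw [norm_mul, norm_mul]
    have hVn : ‖(V y : ℂ)‖ = |V y| := by simp
    have h1 : ‖(V y : ℂ) - a / L‖ ≤ |V y| + A / L :=
      (norm_sub_le _ _).trans (by rw [hVn]; gcongr)
    have h2 : ‖(V y : ℂ) + (w ^ 2 - (k : ℂ) ^ 2 - a / L)‖ ≤
        |V y| + A ^ 2 / (4 * κ ^ 2 * L ^ 2) :=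
      (norm_add_le _ _).trans (by rw [hVn]; gcongr)
    gcongr
  · rw [intervalIntegral.integral_add (hVc.abs.intervalIntegrable _ _) (by simp),
      intervalIntegral.integral_const, smul_eq_mul]
    have h1 : (x - M) * (A / L) ≤ A := by
      rw [mul_div_assoc', div_le_iff₀ hL0]
      nlinarith [hx.1, hx.2]
    have h2 : (1 + A) ≤ k * ((1 + A) / κ) := by
      rw [mul_div_assoc', le_div_iff₀ hκ]; nlinarith
    linarith
  · rw [intervalIntegral.integral_mul_const,
      intervalIntegral.integral_add (hVc.abs.intervalIntegrable _ _) (by simp),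
      intervalIntegral.integral_const, smul_eq_mul]
    gcongr
    calc (x - M) * (A ^ 2 / (4 * κ ^ 2 * L ^ 2)) ≤ L * (A ^ 2 / (4 * κ ^ 2 * L ^ 2)) := by
          gcongr; linarith [hx.2]
      _ = A ^ 2 / (4 * κ ^ 2) / L := by field_simp
      _ ≤ (A ^ 2 / (4 * κ ^ 2) + 1) / L := by gcongr; linarith

theorem exists_cos_approx {κ A B : ℝ} (hκ : 0 < κ) (hA : 1 ≤ A) (hB : 0 ≤ B) :
    ∃ C > 0, ∀ M : ℝ, 0 ≤ M → ∃ H > 0, ∀ L : ℝ, M ≤ L → 1 ≤ L → ∀ V : ℝ → ℝ, Continuous V →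
      (∀ x, |V x| ≤ B) → ∀ δ ≤ 1, ∫ x in M..L, |V x| ≤ δ → ∀ k ≥ κ, ∀ u₀ u₀' : ℝ → ℂ,
      IsNeumannSol V ((k : ℂ) ^ 2) u₀ u₀' → ∃ R φ : ℝ, 0 < R ∧ ∀ a : ℂ, ‖a‖ ≤ A →
      ∀ u u' : ℝ → ℂ, IsNeumannSol V ((k : ℂ) ^ 2 + a / L) u u' →
      (∀ x ∈ Set.Icc 0 M, ‖u x‖ ≤ H * R) ∧
      ∀ x ∈ Set.Icc M L,
        ‖u x - R * Complex.cos ((k + a / (2 * k * L)) * ((x - M : ℝ) : ℂ) + φ)‖ ≤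
          C * (δ + H / L) * R := by
  refine ⟨Real.exp ((1 + A) / κ + 1) * Real.exp (A / (2 * κ)) / κ, by positivity,
    fun M hM => ?_⟩
  set D := Real.exp ((B + A) / κ * M + 1) with hD
  have hD1 : 1 ≤ D := Real.one_le_exp (by positivity)
  set H₀ := 2 * D ^ 2 * (M + 1) * A + A / κ with hH₀
  set H₁ := A ^ 2 / (4 * κ ^ 2) + 1 with hH₁
  refine ⟨H₀ + H₁ + 2 * D, by positivity, fun L hML hL V hVc hV δ hδ1 hδ k hk u₀ u₀' h₀ => ?_⟩
  have hk0 : 0 < k := hκ.trans_le hk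
  have hL0 : 0 < L := by linarith
  have hδ0 : 0 ≤ δ := (intervalIntegral.integral_nonneg hML fun _ _ => abs_nonneg _).trans hδ
  obtain ⟨R, φ, hR0, hR2, hRu, hRu'⟩ := h₀.exists_phase hk0 hV hM
  have hRD : 1 ≤ D * R ^ 2 := by
    have h1 := h₀.one_le_exp_mul hκ hk hV hM
    rw [← hR2] at h1
    refine h1.trans ?_
    gcongr
    rw [hD, Real.exp_le_exp]
    have h2 : B / κ * M ≤ (B + A) / κ * M := by gcongr; linarith
    linarith
  have hR : 0 < R := by
    refine lt_of_le_of_ne hR0 fun h => ?_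
    rw [← h] at hRD
    norm_num at hRD
  refine ⟨R, φ, hR, fun a ha u u' h => ⟨fun x hx => ?_, fun x hx => ?_⟩⟩
  · have haL : ‖a / (L : ℂ)‖ ≤ A := by
      rw [norm_div, Complex.norm_real, Real.norm_of_nonneg hL0.le]
      exact (div_le_self (norm_nonneg _) hL).trans ha
    have h1 := h.sq_norm_le hκ hk hV (A := A) (by simpa using haL) hx
    have h2 : ‖u x‖ ≤ 2 * D * R := by
      refine le_of_sq_le_sq ?_ (by positivity)
      calc ‖u x‖ ^ 2 ≤ 2 * D := h1
        _ ≤ 2 * D * (D * R ^ 2) := le_mul_of_one_le_right (by positivity) hRD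
        _ ≤ (2 * D * R) ^ 2 := by nlinarith [mul_nonneg (sq_nonneg D) (sq_nonneg R)]
    refine h2.trans ?_
    gcongr
    have : 0 ≤ H₀ + H₁ := by positivity
    linarith
  · have hE := h₀.oscEnergy_sub_cos_le h hκ hk hA hVc hV hM hML hL hδ1 hδ hR hRu hRu' hRD ha hx
    set E := Real.exp ((1 + A) / κ + 1) with hEdef
    have hE1 : 1 ≤ E := Real.one_le_exp (by positivity)
    set C₁ := Real.exp (A / (2 * κ)) with hC₁
    have hC₁1 : 1 ≤ C₁ := Real.one_le_exp (by positivity)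
    set e := u x - R * Complex.cos ((k + a / (2 * k * L)) * ((x - M : ℝ) : ℂ) + φ) with he
    have h1 : (κ * ‖e‖) ^ 2 ≤ E * (H₀ / L * R) ^ 2 + E * ((δ + H₁ / L) * (C₁ * R)) ^ 2 := by
      refine le_trans ?_ hE
      rw [oscEnergy, mul_pow]
      have : κ ^ 2 * ‖e‖ ^ 2 ≤ k ^ 2 * ‖e‖ ^ 2 := by gcongr
      refine this.trans (le_add_of_nonneg_left (by positivity))
    have h2 : κ * ‖e‖ ≤ E * (H₀ / L * R + (δ + H₁ / L) * (C₁ * R)) := by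
      refine le_of_sq_le_sq (h1.trans ?_) (by positivity)
      have hX : 0 ≤ H₀ / L * R := by positivity
      have hY : 0 ≤ (δ + H₁ / L) * (C₁ * R) := by positivity
      generalize H₀ / L * R = X at *
      generalize (δ + H₁ / L) * (C₁ * R) = Y at *
      have hEE : E ≤ E ^ 2 := by nlinarith
      calc E * X ^ 2 + E * Y ^ 2 = E * (X ^ 2 + Y ^ 2) := by ring
        _ ≤ E ^ 2 * (X + Y) ^ 2 := by gcongr; nlinarith [mul_nonneg hX hY]
        _ = (E * (X + Y)) ^ 2 := by ring
    have h3 : H₀ / L * R ≤ H₀ / L * (C₁ * R) := by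
      gcongr; exact le_mul_of_one_le_left hR0 hC₁1
    have h4 : 0 ≤ 2 * D / L * (C₁ * R) := by positivity
    have h5 : κ * ‖e‖ ≤ E * ((δ + (H₀ + H₁ + 2 * D) / L) * (C₁ * R)) := by
      refine h2.trans ?_
      gcongr
      have : (δ + (H₀ + H₁ + 2 * D) / L) * (C₁ * R) = H₀ / L * (C₁ * R) +
        (δ + H₁ / L) * (C₁ * R) + 2 * D / L * (C₁ * R) := by ring
      linarith
    have h6 : E * C₁ / κ * (δ + (H₀ + H₁ + 2 * D) / L) * R =
        E * ((δ + (H₀ + H₁ + 2 * D) / L) * (C₁ * R)) / κ := by ring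
    rw [h6, le_div_iff₀ hκ, mul_comm]
    exact h5

end IsNeumannSol

theorem integral_cos_mul_eq_csinc (α : ℂ) (L : ℝ) :
    ∫ t in (0 : ℝ)..L, Complex.cos (α * t) = L * csinc (α * L) := by
  by_cases hα : α = 0
  · simp [hα, csinc]
  by_cases hL : L = 0
  · simp [hL]
  have hLC : (L : ℂ) ≠ 0 := by exact_mod_cast hL
  rw [integral_cos_mul_complex hα, csinc, if_neg (mul_ne_zero hα hLC)]
  simp only [Complex.ofReal_zero, mul_zero, Complex.sin_zero, zero_div, sub_zero]
  field_simp

theorem norm_csinc_le (z : ℂ) : ‖csinc z‖ ≤ Real.exp ‖z‖ := by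
  have h := integral_cos_mul_eq_csinc z 1
  simp only [Complex.ofReal_one, one_mul, mul_one] at h
  rw [← h]
  have := intervalIntegral.norm_integral_le_of_norm_le_const (a := 0) (b := 1)
    (f := fun t : ℝ => Complex.cos (z * t)) (C := Real.exp ‖z‖) (fun t ht => ?_)
  · simpa using this
  · rw [Set.uIoc_of_le zero_le_one] at ht
    refine (norm_cos_le_exp_abs_im _).trans (Real.exp_le_exp.2 ?_)
    refine (Complex.abs_im_le_norm _).trans ?_
    rw [norm_mul, Complex.norm_real, Real.norm_of_nonneg ht.1.le]
    exact mul_le_of_le_one_right (norm_nonneg _) ht.2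

theorem integral_cos_phase {s : ℂ} (hs : s ≠ 0) (M L θ : ℝ) :
    ∫ x in M..L, Complex.cos (s * ((x - M : ℝ) : ℂ) + θ) =
      (Complex.sin (s * ((L - M : ℝ) : ℂ) + θ) - Complex.sin θ) / s := by
  have h : ∀ x : ℝ, HasDerivAt (fun x : ℝ => Complex.sin (s * ((x - M : ℝ) : ℂ) + θ) / s)
      (Complex.cos (s * ((x - M : ℝ) : ℂ) + θ)) x := by
    intro x
    have h1 : HasDerivAt (fun y : ℝ => s * ((y - M : ℝ) : ℂ) + θ) (s * 1) x :=
      ((((hasDerivAt_id x).sub_const M).ofReal_comp).const_mul s).add_const _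
    refine (((Complex.hasDerivAt_sin _).comp x h1).div_const s).congr_deriv ?_
    field_simp
  rw [intervalIntegral.integral_eq_sub_of_hasDerivAt (fun x _ => h x)
    (Continuous.intervalIntegrable (by fun_prop) _ _)]
  simp [sub_div]

theorem norm_integral_cos_mul_cos_sub_le {κ k A M L φ : ℝ} {a b : ℂ} (hκ : 0 < κ) (hk : κ ≤ k)
    (ha : ‖a‖ ≤ A) (hb : ‖b‖ ≤ A) (hM : 0 ≤ M) (hML : M ≤ L) (hL : 0 < L)
    (hLA : A / κ ^ 2 ≤ L) :
    ‖(∫ x in M..L, Complex.cos ((k + a / (2 * k * L)) * ((x - M : ℝ) : ℂ) + φ) *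
        Complex.cos ((k + b / (2 * k * L)) * ((x - M : ℝ) : ℂ) + φ)) -
      L / 2 * csinc ((1 / (2 * k) : ℝ) * (b - a))‖ ≤
      Real.exp (A / κ) * (M / 2 + 1 / κ) := by
  have hk0 : 0 < k := hκ.trans_le hk
  have hkC : (k : ℂ) ≠ 0 := by exact_mod_cast hk0.ne'
  have hLC : (L : ℂ) ≠ 0 := by exact_mod_cast hL.ne'
  have hA0 : 0 ≤ A := (norm_nonneg _).trans ha
  set wa : ℂ := k + a / (2 * k * L) with hwa
  set wb : ℂ := k + b / (2 * k * L) with hwb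
  set C := Real.exp (A / κ) with hC
  have hprod : ∀ x : ℝ, Complex.cos (wa * ((x - M : ℝ) : ℂ) + φ) *
      Complex.cos (wb * ((x - M : ℝ) : ℂ) + φ) =
      (1 / 2) * (Complex.cos ((wb - wa) * ((x - M : ℝ) : ℂ)) +
        Complex.cos ((wa + wb) * ((x - M : ℝ) : ℂ) + (2 * φ : ℝ))) := by
    intro x
    have e1 : (wb - wa) * ((x - M : ℝ) : ℂ) =
      (wb * ((x - M : ℝ) : ℂ) + φ) - (wa * ((x - M : ℝ) : ℂ) + φ) := by ring
    have e2 : (wa + wb) * ((x - M : ℝ) : ℂ) + (2 * φ : ℝ) =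
      (wb * ((x - M : ℝ) : ℂ) + φ) + (wa * ((x - M : ℝ) : ℂ) + φ) := by push_cast; ring
    rw [e1, e2]
    generalize wa * ((x - M : ℝ) : ℂ) + φ = X
    generalize wb * ((x - M : ℝ) : ℂ) + φ = Y
    rw [Complex.cos_sub, Complex.cos_add]
    ring
  have hbound : ∀ t ∈ Set.Icc 0 L, ∀ θ : ℝ, |((wa + wb) * (t : ℂ) + θ).im| ≤ A / κ := by
    intro t ht θ
    have e : (wa + wb) * (t : ℂ) + θ = (wa * t + θ) + (wb * t + (0 : ℝ)) := by push_cast; ring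
    have h1 := abs_im_phase_le (φ := θ) hκ hk hL ha ht.1 ht.2
    have h2 := abs_im_phase_le (φ := 0) hκ hk hL hb ht.1 ht.2
    rw [e, Complex.add_im]
    refine (abs_add_le _ _).trans ((add_le_add h1 h2).trans (le_of_eq ?_))
    field_simp; norm_num
  have hbound' : ∀ t ∈ Set.Icc 0 L, |((wb - wa) * (t : ℂ)).im| ≤ A / κ := by
    intro t ht
    have e : (wb - wa) * (t : ℂ) = (wb * t + (0 : ℝ)) - (wa * t + (0 : ℝ)) := by push_cast; ring
    have h1 := abs_im_phase_le (φ := 0) hκ hk hL ha ht.1 ht.2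
    have h2 := abs_im_phase_le (φ := 0) hκ hk hL hb ht.1 ht.2
    rw [e, Complex.sub_im]
    refine (abs_sub _ _).trans ((add_le_add h2 h1).trans (le_of_eq ?_))
    field_simp; norm_num
  have hs : κ ≤ ‖wa + wb‖ := by
    have e : wa + wb = (2 * k : ℝ) - (-(a + b) / (2 * k * L)) := by
      rw [hwa, hwb]; push_cast; ring
    have h1 : ‖-(a + b) / (2 * k * L : ℂ)‖ ≤ κ := by
      rw [norm_div, norm_neg, norm_mul, norm_mul, Complex.norm_real, Complex.norm_real,
        Real.norm_of_nonneg hk0.le, Real.norm_of_nonneg hL.le, Complex.norm_ofNat,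
        div_le_iff₀ (by positivity)]
      rw [div_le_iff₀ (by positivity)] at hLA
      have h2 := norm_add_le a b
      have h3 : L * κ ^ 2 ≤ L * (κ * k) := by gcongr; nlinarith
      nlinarith
    have h2 := norm_sub_norm_le ((2 * k : ℝ) : ℂ) (-(a + b) / (2 * k * L))
    rw [← e, Complex.norm_real, Real.norm_of_nonneg (by positivity)] at h2
    linarith
  have hs0 : wa + wb ≠ 0 := norm_pos_iff.1 (hκ.trans_le hs)
  have hβ : (wb - wa) * L = (1 / (2 * k) : ℝ) * (b - a) := by
    rw [hwa, hwb]; push_cast; field_simp; ring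
  have hI1 : ∫ x in M..L, Complex.cos ((wb - wa) * ((x - M : ℝ) : ℂ)) =
      L * csinc ((1 / (2 * k) : ℝ) * (b - a)) -
        ∫ t in (L - M)..L, Complex.cos ((wb - wa) * (t : ℂ)) := by
    have hc : Continuous fun t : ℝ => Complex.cos ((wb - wa) * (t : ℂ)) := by fun_prop
    rw [intervalIntegral.integral_comp_sub_right
      (fun t : ℝ => Complex.cos ((wb - wa) * (t : ℂ))) M, sub_self, eq_sub_iff_add_eq,
      intervalIntegral.integral_add_adjacent_intervals (hc.intervalIntegrable _ _)
        (hc.intervalIntegrable _ _), integral_cos_mul_eq_csinc, hβ]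
  have hI1n : ‖∫ t in (L - M)..L, Complex.cos ((wb - wa) * (t : ℂ))‖ ≤ C * M := by
    have := intervalIntegral.norm_integral_le_of_norm_le_const (a := L - M) (b := L)
      (f := fun t : ℝ => Complex.cos ((wb - wa) * (t : ℂ))) (C := C) (fun t ht => ?_)
    · rwa [sub_sub_cancel, abs_of_nonneg hM] at this
    · rw [Set.uIoc_of_le (by linarith)] at ht
      exact (norm_cos_le_exp_abs_im _).trans (Real.exp_le_exp.2
        (hbound' t ⟨by linarith [ht.1], ht.2⟩))
  have hI2n : ‖∫ x in M..L, Complex.cos ((wa + wb) * ((x - M : ℝ) : ℂ) + (2 * φ : ℝ))‖ ≤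
      2 * C / κ := by
    rw [integral_cos_phase hs0, norm_div]
    have h1 : ‖Complex.sin ((wa + wb) * ((L - M : ℝ) : ℂ) + (2 * φ : ℝ))‖ ≤ C :=
      (norm_sin_le_exp_abs_im _).trans (Real.exp_le_exp.2
        (hbound _ ⟨by linarith, by linarith⟩ _))
    have h2 : ‖Complex.sin ((2 * φ : ℝ) : ℂ)‖ ≤ C :=
      (norm_sin_le_exp_abs_im _).trans (Real.exp_le_exp.2 (by
        rw [Complex.ofReal_im, abs_zero]; positivity))
    have h3 := norm_sub_le (Complex.sin ((wa + wb) * ((L - M : ℝ) : ℂ) + (2 * φ : ℝ)))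
      (Complex.sin ((2 * φ : ℝ) : ℂ))
    gcongr
    linarith
  simp_rw [hprod]
  rw [intervalIntegral.integral_const_mul, intervalIntegral.integral_add
    (Continuous.intervalIntegrable (by fun_prop) _ _)
    (Continuous.intervalIntegrable (by fun_prop) _ _), hI1]
  set I1 := ∫ t in (L - M)..L, Complex.cos ((wb - wa) * (t : ℂ))
  set I2 := ∫ x in M..L, Complex.cos ((wa + wb) * ((x - M : ℝ) : ℂ) + (2 * φ : ℝ))
  have e : (1 / 2 : ℂ) * (L * csinc ((1 / (2 * k) : ℝ) * (b - a)) - I1 + I2) -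
      L / 2 * csinc ((1 / (2 * k) : ℝ) * (b - a)) = (1 / 2 : ℂ) * (I2 - I1) := by ring
  rw [e, norm_mul]
  have h1 := norm_sub_le I2 I1
  have h2 : ‖(1 / 2 : ℂ)‖ = 1 / 2 := by norm_num
  rw [h2]
  have h3 : C * (M / 2 + 1 / κ) = 1 / 2 * (2 * C / κ + C * M) := by ring
  rw [h3]
  gcongr
  linarith

theorem norm_integral_mul_sub_csinc_le {κ k A M L φ H η : ℝ} {a b : ℂ} {f g : ℝ → ℂ}
    (hκ : 0 < κ) (hk : κ ≤ k)
    (ha : ‖a‖ ≤ A) (hb : ‖b‖ ≤ A) (hM : 0 ≤ M) (hML : M ≤ L) (hL : 0 < L)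
    (hLA : A / κ ^ 2 ≤ L) (hη : η ≤ 1)
    (hf : ContinuousOn f (Set.Ici 0)) (hg : ContinuousOn g (Set.Ici 0))
    (hfH : ∀ x ∈ Set.Icc 0 M, ‖f x‖ ≤ H) (hgH : ∀ x ∈ Set.Icc 0 M, ‖g x‖ ≤ H)
    (hfη : ∀ x ∈ Set.Icc M L,
      ‖f x - Complex.cos ((k + a / (2 * k * L)) * ((x - M : ℝ) : ℂ) + φ)‖ ≤ η)
    (hgη : ∀ x ∈ Set.Icc M L,
      ‖g x - Complex.cos ((k + b / (2 * k * L)) * ((x - M : ℝ) : ℂ) + φ)‖ ≤ η) :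
    ‖(∫ x in (0 : ℝ)..L, f x * g x) - L / 2 * csinc ((1 / (2 * k) : ℝ) * (b - a))‖ ≤
      M * H ^ 2 + (2 * Real.exp (A / (2 * κ)) + 1) * η * L +
        Real.exp (A / κ) * (M / 2 + 1 / κ) := by
  have hcos := norm_integral_cos_mul_cos_sub_le (φ := φ) hκ hk ha hb hM hML hL hLA
  set ca : ℝ → ℂ := fun x => Complex.cos ((k + a / (2 * k * L)) * ((x - M : ℝ) : ℂ) + φ) with hca
  set cb : ℝ → ℂ := fun x => Complex.cos ((k + b / (2 * k * L)) * ((x - M : ℝ) : ℂ) + φ) with hcb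
  have hcac : Continuous ca := by fun_prop
  have hcbc : Continuous cb := by fun_prop
  have hint : ∀ {x y : ℝ}, 0 ≤ x → x ≤ y →
      IntervalIntegrable (fun x => f x * g x) MeasureTheory.volume x y := fun hx hxy =>
    ((hf.mul hg).mono (by
      rw [Set.uIcc_of_le hxy]; exact fun z hz => hx.trans hz.1)).intervalIntegrable
  have hη0 : 0 ≤ η := (norm_nonneg _).trans (hfη M ⟨le_rfl, hML⟩)
  set C := Real.exp (A / (2 * κ)) with hC
  have h1 : ‖∫ x in (0 : ℝ)..M, f x * g x‖ ≤ M * H ^ 2 := by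
    have := intervalIntegral.norm_integral_le_of_norm_le_const (a := 0) (b := M)
      (f := fun x => f x * g x) (C := H ^ 2) (fun x hx => ?_)
    · rwa [sub_zero, abs_of_nonneg hM, mul_comm] at this
    · rw [Set.uIoc_of_le hM] at hx
      have hx' := Set.Ioc_subset_Icc_self hx
      rw [norm_mul, sq]
      have := (norm_nonneg _).trans (hfH x hx')
      exact mul_le_mul (hfH x hx') (hgH x hx') (norm_nonneg _) this
  have h2 : ‖(∫ x in M..L, f x * g x) - ∫ x in M..L, ca x * cb x‖ ≤ (2 * C + 1) * η * L := by
    rw [← intervalIntegral.integral_sub (hint hM hML)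
      (Continuous.intervalIntegrable (by fun_prop) _ _)]
    have := intervalIntegral.norm_integral_le_of_norm_le_const (a := M) (b := L)
      (f := fun x => f x * g x - ca x * cb x) (C := (2 * C + 1) * η) (fun x hx => ?_)
    · refine this.trans ?_
      rw [abs_of_nonneg (by linarith)]
      have : 0 ≤ (2 * C + 1) * η := by positivity
      gcongr
      linarith
    · rw [Set.uIoc_of_le hML] at hx
      have hx' := Set.Ioc_subset_Icc_self hx
      have hxL : 0 ≤ x - M ∧ x - M ≤ L := ⟨by linarith [hx'.1], by linarith [hx'.2]⟩
      have hCa : ‖ca x‖ ≤ C := (norm_cos_le_exp_abs_im _).trans (Real.exp_le_exp.2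
        (abs_im_phase_le hκ hk hL ha hxL.1 hxL.2))
      have hCb : ‖cb x‖ ≤ C := (norm_cos_le_exp_abs_im _).trans (Real.exp_le_exp.2
        (abs_im_phase_le hκ hk hL hb hxL.1 hxL.2))
      have e : f x * g x - ca x * cb x =
        (f x - ca x) * (g x - cb x) + (f x - ca x) * cb x + ca x * (g x - cb x) := by ring
      have ha' : ‖f x - ca x‖ ≤ η := hfη x hx'
      have hb' : ‖g x - cb x‖ ≤ η := hgη x hx'
      rw [e]
      calc _ ≤ ‖f x - ca x‖ * ‖g x - cb x‖ + ‖f x - ca x‖ * ‖cb x‖ + ‖ca x‖ * ‖g x - cb x‖ := by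
            refine (norm_add₃_le).trans ?_
            rw [norm_mul, norm_mul, norm_mul]
        _ ≤ η * 1 + η * C + C * η := by gcongr; exact hb'.trans hη
        _ = (2 * C + 1) * η := by ring
  rw [← intervalIntegral.integral_add_adjacent_intervals (hint le_rfl hM) (hint hM hML)]
  set I0 := ∫ x in (0 : ℝ)..M, f x * g x
  set I1 := ∫ x in M..L, f x * g x
  set I2 := ∫ x in M..L, ca x * cb x
  have e : I0 + I1 - L / 2 * csinc ((1 / (2 * k) : ℝ) * (b - a)) =
    I0 + (I1 - I2) + (I2 - L / 2 * csinc ((1 / (2 * k) : ℝ) * (b - a))) := by ring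
  rw [e]
  refine (norm_add₃_le).trans ?_
  gcongr

theorem norm_div_sub_le {s e₁ e₂ : ℂ} {e C : ℝ} (h₁ : ‖e₁‖ ≤ e) (h₂ : ‖e₂‖ ≤ e)
    (he : e ≤ 1 / 2) (hs : ‖s‖ ≤ C) : ‖(s + e₁) / (1 + e₂) - s‖ ≤ 2 * e * (1 + C) := by
  have he0 : 0 ≤ e := (norm_nonneg _).trans h₁
  have hC0 : 0 ≤ C := (norm_nonneg _).trans hs
  have h3 : 1 / 2 ≤ ‖1 + e₂‖ := by
    have := norm_sub_norm_le (1 : ℂ) (-e₂)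
    rw [sub_neg_eq_add, norm_neg, norm_one] at this
    linarith
  have h4 : 1 + e₂ ≠ 0 := norm_pos_iff.1 (by linarith)
  have h5 : (s + e₁) / (1 + e₂) - s = (e₁ - s * e₂) / (1 + e₂) := by field_simp; ring
  rw [h5, norm_div, div_le_iff₀ (by linarith)]
  have h6 := norm_sub_le e₁ (s * e₂)
  rw [norm_mul] at h6
  have h7 : ‖s‖ * ‖e₂‖ ≤ C * e := by gcongr
  have h8 : 0 ≤ 2 * e * (1 + C) := by positivity
  nlinarith

theorem csinc_zero : csinc 0 = 1 := if_pos rfl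

theorem exists_threshold {κ A B ε : ℝ} (hκ : 0 < κ) (hA : 1 ≤ A) (hB : 0 ≤ B) (hε : 0 < ε) :
    ∃ δ₀ > 0, ∀ M : ℝ, 0 ≤ M → ∃ T : ℝ, ∀ L ≥ T, ∀ V : ℝ → ℝ, Continuous V →
      (∀ x, |V x| ≤ B) → ∫ x in M..L, |V x| ≤ δ₀ → ∀ k ≥ κ, ∀ a b : ℂ, ‖a‖ ≤ A → ‖b‖ ≤ A →
      ∀ u₀ u₀' ua ua' ub ub' : ℝ → ℂ, IsNeumannSol V ((k : ℂ) ^ 2) u₀ u₀' →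
      IsNeumannSol V ((k : ℂ) ^ 2 + a / L) ua ua' →
      IsNeumannSol V ((k : ℂ) ^ 2 + b / L) ub ub' →
      ‖(∫ r in (0 : ℝ)..L, ua r * ub r) / (∫ r in (0 : ℝ)..L, u₀ r * u₀ r) -
        csinc ((1 / (2 * k) : ℝ) * (b - a))‖ < ε := by
  obtain ⟨C, hC, hCM⟩ := IsNeumannSol.exists_cos_approx (B := B) hκ hA hB
  set C₁ := Real.exp (A / (2 * κ)) with hC₁
  set C₂ := Real.exp (A / κ) with hC₂
  have hC₁0 : 0 < C₁ := Real.exp_pos _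
  have hC₂0 : 0 < C₂ := Real.exp_pos _
  set e := min (1 / 2) (ε / (4 * (1 + C₂))) with he
  have he0 : 0 < e := by positivity
  have he2 : e ≤ 1 / 2 := min_le_left _ _
  have heε : 2 * e * (1 + C₂) < ε := by
    have : e ≤ ε / (4 * (1 + C₂)) := min_le_right _ _
    rw [le_div_iff₀ (by positivity)] at this
    linarith
  set Q := 2 * (2 * C₁ + 1) * C with hQ
  have hQ0 : 0 < Q := by positivity
  refine ⟨min 1 (e / (2 * Q)), by positivity, fun M hM => ?_⟩
  set δ₀ := min 1 (e / (2 * Q)) with hδ₀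
  have hδ1 : δ₀ ≤ 1 := min_le_left _ _
  have hδQ : Q * δ₀ ≤ e / 2 := by
    have : δ₀ ≤ e / (2 * Q) := min_le_right _ _
    rw [le_div_iff₀ (by positivity)] at this
    linarith
  have hδ0 : 0 < δ₀ := by positivity
  obtain ⟨H, hH, hHL⟩ := hCM M hM
  set P := 2 * (M * H ^ 2) + Q * H + 2 * (C₂ * (M / 2 + 1 / κ)) with hP
  have hP0 : 0 < P := by positivity
  refine ⟨max (max 1 M) (max (A / κ ^ 2) (2 * P / e)), ?_⟩
  intro L hL V hVc hV hVδ k hk a b ha hb u₀ u₀' ua ua' ub ub' h₀ hua hub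
  have hL1 : 1 ≤ L := ((le_max_left _ _).trans (le_max_left _ _)).trans hL
  have hML : M ≤ L := ((le_max_right _ _).trans (le_max_left _ _)).trans hL
  have hLA : A / κ ^ 2 ≤ L := ((le_max_left _ _).trans (le_max_right _ _)).trans hL
  have hLP : 2 * P / e ≤ L := ((le_max_right _ _).trans (le_max_right _ _)).trans hL
  have hL0 : 0 < L := by linarith
  have hLC : (L : ℂ) ≠ 0 := by exact_mod_cast hL0.ne'
  have hPL : P / L ≤ e / 2 := by
    rw [div_le_iff₀ he0] at hLP
    rw [div_le_iff₀ hL0]; linarith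
  obtain ⟨R, φ, hR, hsol⟩ := hHL L hML hL1 V hVc hV δ₀ hδ1 hVδ k hk u₀ u₀' h₀
  have hRC : (R : ℂ) ≠ 0 := by exact_mod_cast hR.ne'
  set η := C * (δ₀ + H / L) with hη
  have htot : 2 / L * (M * H ^ 2 + (2 * C₁ + 1) * η * L + C₂ * (M / 2 + 1 / κ)) ≤ e := by
    have : 2 / L * (M * H ^ 2 + (2 * C₁ + 1) * η * L + C₂ * (M / 2 + 1 / κ)) =
        P / L + Q * δ₀ := by
      rw [hP, hQ, hη]; field_simp; ring
    linarith
  have hη0 : 0 < η := by positivity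
  have hη1 : η ≤ 1 := by
    have h1 : 2 / L * ((2 * C₁ + 1) * η * L) ≤ e := by
      refine le_trans ?_ htot
      have h2 : 0 ≤ M * H ^ 2 := by positivity
      have h3 : 0 ≤ C₂ * (M / 2 + 1 / κ) := by positivity
      gcongr
      linarith
    have h4 : 2 / L * ((2 * C₁ + 1) * η * L) = 2 * η + 4 * (C₁ * η) := by field_simp; ring
    have h5 : 0 < C₁ * η := by positivity
    linarith
  have main : ∀ (a b : ℂ) (u u' v v' : ℝ → ℂ), ‖a‖ ≤ A → ‖b‖ ≤ A →
      IsNeumannSol V ((k : ℂ) ^ 2 + a / L) u u' → IsNeumannSol V ((k : ℂ) ^ 2 + b / L) v v' →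
      ∃ d : ℂ, ‖d‖ ≤ e ∧ ∫ r in (0 : ℝ)..L, u r * v r =
        (R ^ 2 * L / 2) * (csinc ((1 / (2 * k) : ℝ) * (b - a)) + d) := by
    intro a b u u' v v' ha hb hu hv
    have hscale : ∀ (a : ℂ) (u u' : ℝ → ℂ), ‖a‖ ≤ A →
        IsNeumannSol V ((k : ℂ) ^ 2 + a / L) u u' →
        ContinuousOn (fun x => u x / R) (Set.Ici 0) ∧
        (∀ x ∈ Set.Icc 0 M, ‖u x / R‖ ≤ H) ∧ ∀ x ∈ Set.Icc M L,
        ‖u x / R - Complex.cos ((k + a / (2 * k * L)) * ((x - M : ℝ) : ℂ) + φ)‖ ≤ η := by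
      intro a u u' ha hu
      obtain ⟨h1, h2⟩ := hsol a ha u u' hu
      refine ⟨hu.continuousOn.div_const _, fun x hx => ?_, fun x hx => ?_⟩
      · rw [norm_div, Complex.norm_real, Real.norm_of_nonneg hR.le, div_le_iff₀ hR]
        exact h1 x hx
      · have h3 : u x / R - Complex.cos ((k + a / (2 * k * L)) * ((x - M : ℝ) : ℂ) + φ) =
            (u x - R * Complex.cos ((k + a / (2 * k * L)) * ((x - M : ℝ) : ℂ) + φ)) / R := by
          field_simp
        rw [h3, norm_div, Complex.norm_real, Real.norm_of_nonneg hR.le, div_le_iff₀ hR]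
        exact h2 x hx
    obtain ⟨hu1, hu2, hu3⟩ := hscale a u u' ha hu
    obtain ⟨hv1, hv2, hv3⟩ := hscale b v v' hb hv
    have key := norm_integral_mul_sub_csinc_le hκ hk ha hb hM hML hL0 hLA hη1 hu1 hv1 hu2 hv2
      hu3 hv3
    have hI : ∫ r in (0 : ℝ)..L, u r / R * (v r / R) =
        (∫ r in (0 : ℝ)..L, u r * v r) / R ^ 2 := by
      rw [← intervalIntegral.integral_div]
      congr 1
      ext r
      field_simp
    rw [hI] at key
    set s := csinc ((1 / (2 * k) : ℝ) * (b - a))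
    set I := ∫ r in (0 : ℝ)..L, u r * v r
    refine ⟨2 / L * (I / R ^ 2 - L / 2 * s), ?_, ?_⟩
    · rw [norm_mul, norm_div, Complex.norm_ofNat, Complex.norm_real, Real.norm_of_nonneg hL0.le]
      refine le_trans ?_ htot
      gcongr
    · field_simp
      ring
  obtain ⟨d₁, hd₁, hI₁⟩ := main a b ua ua' ub ub' ha hb hua hub
  obtain ⟨d₂, hd₂, hI₂⟩ := main 0 0 u₀ u₀' u₀ u₀' (by simpa using by linarith)
    (by simpa using by linarith) (by simpa using h₀) (by simpa using h₀)
  rw [sub_zero, mul_zero, csinc_zero] at hI₂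
  rw [hI₁, hI₂, mul_div_mul_left _ _ (by simp [hRC, hLC])]
  refine (norm_div_sub_le hd₁ hd₂ he2 ?_).trans_lt heε
  refine (norm_csinc_le _).trans (Real.exp_le_exp.2 ?_)
  have hk0 : 0 < k := hκ.trans_le hk
  rw [norm_mul, Complex.norm_real, Real.norm_of_nonneg (by positivity)]
  have h1 : ‖b - a‖ ≤ 2 * A := (norm_sub_le _ _).trans (by linarith)
  calc 1 / (2 * k) * ‖b - a‖ ≤ 1 / (2 * κ) * (2 * A) := by gcongr
    _ = A / κ := by field_simp

/-- The Pearson potential with profile `W`, coupling constants `lam` and bump positions `N`. -/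
noncomputable def pearsonPotential (W : ℝ → ℝ) (lam N : ℕ → ℝ) (x : ℝ) : ℝ :=
  ∑' n, lam n * W (x - N n)

section Pearson

variable {W : ℝ → ℝ} {lam N : ℕ → ℝ}

theorem add_one_lt_of_lt (hN : ∀ n, N n + 1 < N (n + 1)) {m n : ℕ} (h : m < n) :
    N m + 1 < N n := by
  have hmono : StrictMono N := strictMono_nat_of_lt_succ fun n => by linarith [hN n]
  exact (hN m).trans_le (hmono.monotone h)

theorem mem_Ioo_of_ne_zero (hW : Continuous W) (hWsupp : Function.support W ⊆ Set.Icc 0 1)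
    {x : ℝ} (hx : W x ≠ 0) : x ∈ Set.Ioo 0 1 := by
  rw [← interior_Icc]
  exact interior_maximal hWsupp hW.isOpen_support hx

theorem pearsonPotential_eq_single (hW : Continuous W)
    (hWsupp : Function.support W ⊆ Set.Icc 0 1) (hN : ∀ n, N n + 1 < N (n + 1)) {x : ℝ} {n : ℕ}
    (hlo : ∀ m < n, N m + 1 ≤ x) (hhi : x ≤ N (n + 1)) :
    pearsonPotential W lam N x = lam n * W (x - N n) := by
  refine tsum_eq_single n fun m hm => ?_
  by_contra h
  have h1 := mem_Ioo_of_ne_zero hW hWsupp (right_ne_zero_of_mul h)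
  rcases lt_or_gt_of_ne hm with hlt | hgt
  · linarith [hlo m hlt, h1.2]
  · have hmono : StrictMono N := strictMono_nat_of_lt_succ fun n => by linarith [hN n]
    have : N (n + 1) ≤ N m := hmono.monotone hgt
    linarith [h1.1]

theorem abs_pearsonPotential_le (hW : Continuous W)
    (hWsupp : Function.support W ⊆ Set.Icc 0 1) (hN : ∀ n, N n + 1 < N (n + 1)) {Λ C : ℝ}
    (hΛ : ∀ n, |lam n| ≤ Λ) (hC : ∀ x, |W x| ≤ C) (x : ℝ) :
    |pearsonPotential W lam N x| ≤ Λ * C := by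
  have hΛ0 : 0 ≤ Λ := (abs_nonneg _).trans (hΛ 0)
  have hC0 : 0 ≤ C := (abs_nonneg _).trans (hC 0)
  by_cases h : ∃ n, W (x - N n) ≠ 0
  · obtain ⟨n, hn⟩ := h
    have h1 := mem_Ioo_of_ne_zero hW hWsupp hn
    rw [pearsonPotential_eq_single (n := n) hW hWsupp hN, abs_mul]
    · gcongr
      · exact hΛ n
      · exact hC _
    · intro m hm
      linarith [add_one_lt_of_lt hN hm, h1.1]
    · linarith [hN n, h1.2]
  · push Not at h
    simp only [pearsonPotential, h, mul_zero, tsum_zero, abs_zero]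
    positivity

theorem continuous_pearsonPotential (hW : Continuous W)
    (hWsupp : Function.support W ⊆ Set.Icc 0 1) (hN : Monotone N)
    (hNtop : Filter.Tendsto N Filter.atTop Filter.atTop) :
    Continuous (pearsonPotential W lam N) := by
  rw [continuous_iff_continuousAt]
  intro x
  obtain ⟨n, hn⟩ := (hNtop.eventually_ge_atTop (x + 1)).exists
  have heq : pearsonPotential W lam N =ᶠ[nhds x]
      fun y => ∑ m ∈ Finset.range n, lam m * W (y - N m) := by
    filter_upwards [Iio_mem_nhds (lt_add_one x)] with y hy
    refine tsum_eq_sum fun m hm => ?_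
    by_contra h
    have h1 := mem_Ioo_of_ne_zero hW hWsupp (right_ne_zero_of_mul h)
    have h2 : N n ≤ N m := hN (by simpa using hm)
    have h3 : y < x + 1 := hy
    linarith [h1.1]
  exact (Continuous.continuousAt (by fun_prop)).congr heq.symm

theorem integral_abs_pearsonPotential_le (hW : Continuous W) (hW0 : ∀ x, 0 ≤ W x)
    (hWsupp : Function.support W ⊆ Set.Icc 0 1) (hN : ∀ n, N n + 1 < N (n + 1)) {n : ℕ} {L : ℝ}
    (hL : N (n + 1) ≤ L) (hL' : L ≤ N (n + 2)) :
    ∫ x in (N n + 1)..L, |pearsonPotential W lam N x| ≤ |lam (n + 1)| * ∫ x, W x := by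
  have hML : N n + 1 ≤ L := (hN n).le.trans hL
  have hmono : StrictMono N := strictMono_nat_of_lt_succ fun n => by linarith [hN n]
  have hint : MeasureTheory.Integrable W :=
    hW.integrable_of_hasCompactSupport (HasCompactSupport.intro isCompact_Icc fun x hx => by
      by_contra h; exact hx (hWsupp h))
  have h1 : ∫ x in (N n + 1)..L, |pearsonPotential W lam N x| =
      ∫ x in (N n + 1)..L, |lam (n + 1)| * W (x - N (n + 1)) := by
    refine intervalIntegral.integral_congr fun x hx => ?_
    rw [Set.uIcc_of_le hML] at hx
    rw [pearsonPotential_eq_single (n := n + 1) hW hWsupp hN, abs_mul, abs_of_nonneg (hW0 _)]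
    · intro m hm
      have : N m ≤ N n := hmono.monotone (by omega)
      linarith [hx.1]
    · exact hx.2.trans hL'
  rw [h1, intervalIntegral.integral_const_mul, intervalIntegral.integral_of_le hML]
  gcongr
  rw [← MeasureTheory.integral_sub_right_eq_self W (N (n + 1))]
  exact MeasureTheory.setIntegral_le_integral (hint.comp_sub_right _)
    (Filter.Eventually.of_forall fun x => hW0 _)

end Pearson

/-- Bump positions growing fast enough to pass the thresholds `T 0, …, T n` at step `n`. -/
noncomputable def sparsePositions (T : ℕ → ℝ → ℝ) : ℕ → ℝ
  | 0 => 1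
  | n + 1 => (n + 2) * sparsePositions T n + 2 +
      ∑ m ∈ Finset.range (n + 1), |T m (sparsePositions T n + 1)|

section SparsePositions

variable (T : ℕ → ℝ → ℝ)

theorem sparsePositions_pos (n : ℕ) : 0 < sparsePositions T n := by
  induction n with
  | zero => exact one_pos
  | succ n ih => rw [sparsePositions]; positivity

theorem mul_sparsePositions_le (n : ℕ) :
    (n + 2) * sparsePositions T n + 2 ≤ sparsePositions T (n + 1) := by
  rw [sparsePositions]
  exact le_add_of_nonneg_right (by positivity)

theorem sparsePositions_add_one_lt (n : ℕ) :
    sparsePositions T n + 1 < sparsePositions T (n + 1) := by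
  have h1 := mul_sparsePositions_le T n
  have h2 : 0 ≤ (n : ℝ) * sparsePositions T n := by
    have := sparsePositions_pos T n; positivity
  nlinarith [sparsePositions_pos T n]

theorem strictMono_sparsePositions : StrictMono (sparsePositions T) :=
  strictMono_nat_of_lt_succ fun n => by linarith [sparsePositions_add_one_lt T n]

theorem tendsto_sparsePositions_atTop :
    Filter.Tendsto (sparsePositions T) Filter.atTop Filter.atTop := by
  refine Filter.tendsto_atTop_mono (f := fun n : ℕ => (n : ℝ)) (fun n => ?_)
    tendsto_natCast_atTop_atTop
  induction n with
  | zero => simpa using (sparsePositions_pos T 0).le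
  | succ n ih => push_cast; linarith [sparsePositions_add_one_lt T n]

theorem tendsto_sparsePositions_div :
    Filter.Tendsto (fun n => sparsePositions T n / sparsePositions T (n + 1)) Filter.atTop
      (nhds 0) := by
  refine squeeze_zero (fun n => (div_pos (sparsePositions_pos T n)
    (sparsePositions_pos T (n + 1))).le) (fun n => ?_) tendsto_one_div_add_atTop_nhds_zero_nat
  rw [div_le_div_iff₀ (sparsePositions_pos T (n + 1)) (by positivity)]
  linarith [mul_sparsePositions_le T n, sparsePositions_pos T n]

theorem threshold_le_sparsePositions {m n : ℕ} (h : m ≤ n) :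
    T m (sparsePositions T n + 1) ≤ sparsePositions T (n + 1) := by
  rw [sparsePositions]
  have h1 : |T m (sparsePositions T n + 1)| ≤
      ∑ m ∈ Finset.range (n + 1), |T m (sparsePositions T n + 1)| :=
    Finset.single_le_sum (f := fun m => |T m (sparsePositions T n + 1)|)
      (fun _ _ => abs_nonneg _) (Finset.mem_range.2 (by omega))
  have h2 : 0 ≤ (n + 2) * sparsePositions T n := by
    have := sparsePositions_pos T n; positivity
  linarith [le_abs_self (T m (sparsePositions T n + 1))]

end SparsePositions

theorem exists_between_succ {N : ℕ → ℝ} (hN : Monotone N)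
    (hNtop : Filter.Tendsto N Filter.atTop Filter.atTop) {n₀ : ℕ} {L : ℝ} (hL : N (n₀ + 1) ≤ L) :
    ∃ n ≥ n₀, N (n + 1) ≤ L ∧ L ≤ N (n + 2) := by
  have hex : ∃ j, L < N j := (hNtop.eventually_gt_atTop L).exists
  classical
  have h1 : L < N (Nat.find hex) := Nat.find_spec hex
  have h2 : n₀ + 1 < Nat.find hex := by
    by_contra h
    linarith [hN (not_lt.1 h)]
  obtain ⟨n, hn⟩ : ∃ n, Nat.find hex = n + 2 := ⟨Nat.find hex - 2, by omega⟩
  refine ⟨n, by omega, not_lt.1 (Nat.find_min hex (by omega)), ?_⟩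
  rw [← hn]
  exact h1.le

theorem exists_nat_bounds {K : Set ℝ} (hK : IsCompact K) (hKpos : K ⊆ Set.Ioi 0) {K' : Set ℂ}
    (hK' : IsCompact K') {ε : ℝ} (hε : 0 < ε) :
    ∃ m : ℕ, 1 / ((m : ℝ) + 1) ≤ ε ∧ (∀ ξ ∈ K, 1 / ((m : ℝ) + 1) ≤ √ξ) ∧
      ∀ a ∈ K', ‖a‖ ≤ (m : ℝ) + 1 := by
  obtain ⟨c, hc, hcK⟩ : ∃ c > 0, ∀ ξ ∈ K, c ≤ √ξ := by
    rcases K.eq_empty_or_nonempty with rfl | hne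
    · exact ⟨1, one_pos, by simp⟩
    · obtain ⟨ξ₀, h₀, hmin⟩ := hK.exists_isMinOn hne continuousOn_id
      exact ⟨√ξ₀, Real.sqrt_pos.2 (hKpos h₀), fun ξ hξ => Real.sqrt_le_sqrt (hmin hξ)⟩
  obtain ⟨r, hr⟩ := hK'.isBounded.exists_norm_le
  have h1 := tendsto_one_div_add_atTop_nhds_zero_nat (𝕜 := ℝ)
  obtain ⟨m, h2, h3, h4⟩ := ((h1.eventually_le_const hε).and ((h1.eventually_le_const hc).and
    (tendsto_natCast_atTop_atTop.eventually_ge_atTop r))).exists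
  exact ⟨m, h2, fun ξ hξ => h3.trans (hcK ξ hξ), fun a ha => by linarith [hr a ha]⟩

/-- Main theorem: for any smooth nonnegative `W` supported in `[0,1]` and any `λₙ → 0`,
there is a sufficiently sparse sequence `Nₙ` such that for the Pearson potential
`V(x) = Σₙ λₙ W(x − Nₙ)` the renormalized Christoffel–Darboux kernel converges to the sine
kernel, uniformly for `ξ` in compact subsets of `(0,∞)` and `a, b` in compact subsets of the
strip `|Im z| ≤ 1`. -/
theorem pearson_sine_kernel_universality (W : ℝ → ℝ) (hWsmooth : ContDiff ℝ (⊤ : ℕ∞) W)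
    (hWnonneg : ∀ x, 0 ≤ W x) (hWsupp : Function.support W ⊆ Set.Icc 0 1)
    (lam : ℕ → ℝ) (hlam : Filter.Tendsto lam Filter.atTop (nhds 0)) :
    ∃ N : ℕ → ℝ, (∀ n, 0 < N n) ∧ StrictMono N ∧ (∀ n, N n + 1 < N (n + 1)) ∧
      Filter.Tendsto (fun n => N n / N (n + 1)) Filter.atTop (nhds 0) ∧
      ∀ u u' : ℂ → ℝ → ℂ,
        (∀ ξ : ℂ, ∀ x ∈ Set.Ici (0 : ℝ), HasDerivWithinAt (u ξ) (u' ξ x) (Set.Ici 0) x) →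
        (∀ ξ : ℂ, ∀ x ∈ Set.Ici (0 : ℝ),
          HasDerivWithinAt (u' ξ)
            ((((∑' n, lam n * W (x - N n) : ℝ) : ℂ) - ξ) * u ξ x) (Set.Ici 0) x) →
        (∀ ξ : ℂ, u ξ 0 = 1) → (∀ ξ : ℂ, u' ξ 0 = 0) →
        ∀ K : Set ℝ, IsCompact K → K ⊆ Set.Ioi 0 →
        ∀ K' : Set ℂ, IsCompact K' → K' ⊆ {z : ℂ | |z.im| ≤ 1} →
        TendstoUniformlyOn
          (fun (L : ℝ) (p : ℝ × ℂ × ℂ) =>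
            (∫ r in (0 : ℝ)..L, u ((p.1 : ℂ) + p.2.1 / L) r * u ((p.1 : ℂ) + p.2.2 / L) r) /
              ∫ r in (0 : ℝ)..L, u (p.1 : ℂ) r * u (p.1 : ℂ) r)
          (fun p => csinc ((π * freeDOS p.1 : ℝ) * (p.2.2 - p.2.1)))
          Filter.atTop (K ×ˢ K' ×ˢ K') := by
  have hW : Continuous W := hWsmooth.continuous
  obtain ⟨C, hC⟩ := hW.bounded_above_of_compact_support (HasCompactSupport.intro isCompact_Icc
    fun x hx => by by_contra h; exact hx (hWsupp h))
  simp only [Real.norm_eq_abs] at hC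
  obtain ⟨Λ, hΛ⟩ := hlam.abs.bddAbove_range
  replace hΛ : ∀ n, |lam n| ≤ Λ := fun n => hΛ (Set.mem_range_self n)
  have hB : 0 ≤ Λ * C :=
    mul_nonneg ((abs_nonneg _).trans (hΛ 0)) ((abs_nonneg _).trans (hC 0))
  have hthr := fun m : ℕ => exists_threshold (κ := 1 / ((m : ℝ) + 1)) (A := (m : ℝ) + 1)
    (ε := 1 / ((m : ℝ) + 1)) (by positivity) (by simp) hB (by positivity)
  choose δ hδ hT using hthr
  have hT' : ∀ (m : ℕ) (M : ℝ), ∃ T : ℝ, 0 ≤ M → _ := fun m M => by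
    by_cases hM : 0 ≤ M
    · obtain ⟨T, hT⟩ := hT m M hM
      exact ⟨T, fun _ => hT⟩
    · exact ⟨0, fun h => absurd h hM⟩
  choose T hT using hT'
  have hgap := sparsePositions_add_one_lt T
  have hmono := strictMono_sparsePositions T
  have htop := tendsto_sparsePositions_atTop T
  refine ⟨sparsePositions T, sparsePositions_pos T, hmono, hgap,
    tendsto_sparsePositions_div T, ?_⟩
  intro u u' hu hu' hu0 hu0' K hK hKpos K' hK' _
  have hsol : ∀ ξ, IsNeumannSol (pearsonPotential W lam (sparsePositions T)) ξ (u ξ) (u' ξ) :=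
    fun ξ => ⟨hu ξ, hu' ξ, hu0 ξ, hu0' ξ⟩
  rw [Metric.tendstoUniformlyOn_iff]
  intro ε hε
  obtain ⟨m, hmε, hmK, hmK'⟩ := exists_nat_bounds hK hKpos hK' hε
  have hlim : Filter.Tendsto (fun n => |lam (n + 1)| * ∫ x, W x) Filter.atTop (nhds 0) := by
    have := ((Filter.tendsto_add_atTop_iff_nat 1).2 hlam).abs.mul_const (∫ x, W x)
    simpa using this
  obtain ⟨n₀, hn₀⟩ := Filter.eventually_atTop.1 ((hlim.eventually_le_const (hδ m)).and
    (Filter.eventually_ge_atTop m))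
  filter_upwards [Filter.eventually_ge_atTop (sparsePositions T (n₀ + 1))] with L hL
  rintro ⟨ξ, a, b⟩ ⟨hξ, ha, hb⟩
  obtain ⟨n, hn, hnL, hLn⟩ := exists_between_succ hmono.monotone htop hL
  obtain ⟨hlamn, hmn⟩ := hn₀ n hn
  have hsq : ((√ξ : ℝ) : ℂ) ^ 2 = ξ := by
    exact_mod_cast Real.sq_sqrt (le_of_lt (hKpos hξ))
  have hdos : π * freeDOS ξ = 1 / (2 * √ξ) := by
    rw [freeDOS]; field_simp
  have key := hT m (sparsePositions T n + 1)
    (by linarith [sparsePositions_pos T n]) L ((threshold_le_sparsePositions T hmn).trans hnL)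
    (pearsonPotential W lam (sparsePositions T))
    (continuous_pearsonPotential hW hWsupp hmono.monotone htop)
    (abs_pearsonPotential_le hW hWsupp hgap hΛ hC)
    ((integral_abs_pearsonPotential_le hW hWnonneg hWsupp hgap hnL hLn).trans hlamn)
    (√ξ) (hmK ξ hξ) a b (hmK' a ha) (hmK' b hb) (u ξ) (u' ξ) (u (ξ + a / L)) (u' (ξ + a / L))
    (u (ξ + b / L)) (u' (ξ + b / L)) (by rw [hsq]; exact hsol _) (by rw [hsq]; exact hsol _)
    (by rw [hsq]; exact hsol _)
  rw [dist_comm, dist_eq_norm]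
  dsimp only
  rw [hdos]
  exact key.trans_le hmε
end

section
/- Let V : [0,∞) → ℝ be continuous, let u(ξ,·) be the Neumann solution of −∂ₓ²u + V·u = ξ·u (complex-valued for complex ξ), and let S_L(ξ,ζ) = ∫₀^L u(ξ,r)·u(ζ,r) dr. Assume: (i) there is a continuous function ρ : (0,∞) → (0,∞) such that S_L(ξ + a/L, ξ + b/L)/S_L(ξ,ξ) → sin(π·ρ(ξ)·(b−a))/(π·ρ(ξ)·(b−a)) as L → ∞, uniformly for ξ in compact subsets of (0,∞) and a, b in compact subsets of the strip {z ∈ ℂ : |Im z| ≤ 1}; (ii) for each L > 0 the set Z_L = {ξ ∈ ℝ : ∂ₓu(ξ,L) = 0} is discrete and the measures ν_L = (1/L)·Σ_{ξ ∈ Z_L} δ_ξ converge weakly, as L → ∞, to the measure on (0,∞) with density ρ with respect to Lebesgue measure. Then uniform clock behavior holds on every compact interval I ⊂ (0,∞): for each fixed n ∈ ℤ, L·(ξₙ₊₁ᴸ(ξ*) − ξₙᴸ(ξ*))·ρ(ξ*) → 1 as L → ∞, uniformly in ξ* ∈ I, where the elements of Z_L are enumerated around ξ* as ... < ξ₋₁ᴸ(ξ*)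 < ξ* ≤ ξ₀ᴸ(ξ*) < ξ₁ᴸ(ξ*) < ... . -/
open scoped Real

/-- `x` is the `n`-th point of the set `Z` around the reference point `c`, for the
enumeration `... < ξ₋₁ < c ≤ ξ₀ < ξ₁ < ...`: for `n ≥ 0` there are exactly `n` points of
`Z` in `[c, x)`, and for `n < 0` there are exactly `-n-1` points of `Z` in `(x, c)`. -/
def IsNthPoint (Z : Set ℝ) (c : ℝ) (n : ℤ) (x : ℝ) : Prop :=
  x ∈ Z ∧
    ((0 ≤ n ∧ c ≤ x ∧ (Z ∩ Set.Ico c x).Finite ∧ (Z ∩ Set.Ico c x).ncard = n.toNat) ∨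
      (n < 0 ∧ x < c ∧ (Z ∩ Set.Ioo x c).Finite ∧ (Z ∩ Set.Ioo x c).ncard = (-n - 1).toNat))

/-- On the real line `csinc` is the real function `Real.sinc`. -/
theorem csinc_ofReal (t : ℝ) : csinc (t : ℂ) = (Real.sinc t : ℂ) := by
  by_cases ht : t = 0
  · simp [csinc, ht]
  · simp [csinc, ht, Real.sinc_of_ne_zero ht]

theorem sinc_pos_of_mem_Ico {t : ℝ} (h0 : 0 ≤ t) (h1 : t < π) : 0 < Real.sinc t := by
  rcases h0.eq_or_lt with rfl | h
  · simp
  · rw [Real.sinc_of_ne_zero h.ne']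
    exact div_pos (Real.sin_pos_of_pos_of_lt_pi h h1) h

/-- `sinc` is bounded below by a positive constant on `[0, π(1-ε)]`. -/
theorem exists_pos_le_sinc {ε : ℝ} (hε : 0 < ε) :
    ∃ m > 0, ∀ t ∈ Set.Icc 0 (π * (1 - ε)), m ≤ Real.sinc t := by
  refine isCompact_Icc.exists_forall_le' Real.continuous_sinc.continuousOn fun t ht => ?_
  refine sinc_pos_of_mem_Ico ht.1 (ht.2.trans_lt ?_)
  nlinarith [Real.pi_pos]

theorem sinc_pi_mul_one_add_neg {ε : ℝ} (hε : 0 < ε) (hε1 : ε < 1) :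
    Real.sinc (π * (1 + ε)) < 0 := by
  have hpos : 0 < π * (1 + ε) := by positivity
  rw [Real.sinc_of_ne_zero hpos.ne', show π * (1 + ε) = π * ε + π by ring, Real.sin_add_pi]
  refine div_neg_of_neg_of_pos (neg_neg_of_pos ?_) (by positivity)
  exact Real.sin_pos_of_pos_of_lt_pi (by positivity) (by nlinarith [Real.pi_pos])

/-- Consecutive points of the enumeration have no point of the set between them. -/
theorem IsNthPoint.lt_and_forall_notMem {Z : Set ℝ} {c : ℝ} {n : ℤ} {x y : ℝ}
    (hx : IsNthPoint Z c n x) (hy : IsNthPoint Z c (n + 1) y) :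
    x < y ∧ ∀ z ∈ Set.Ioo x y, z ∉ Z := by
  obtain ⟨hxZ, hx⟩ := hx
  obtain ⟨hyZ, hy⟩ := hy
  rcases hx with ⟨hn, hcx, hfx, hnx⟩ | ⟨hn, hcx, hfx, hnx⟩ <;>
    rcases hy with ⟨hn', hcy, hfy, hny⟩ | ⟨hn', hcy, hfy, hny⟩
  · have hxy : x < y := by
      by_contra! h
      have := Set.ncard_le_ncard
        (Set.inter_subset_inter_right Z (Set.Ico_subset_Ico_right h : Set.Ico c y ⊆ Set.Ico c x)) hfx
      omega
    refine ⟨hxy, fun z hz hzZ => ?_⟩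
    have hsub : insert z (insert x (Z ∩ Set.Ico c x)) ⊆ Z ∩ Set.Ico c y := by
      rintro w (rfl | rfl | hw)
      · exact ⟨hzZ, hcx.trans hz.1.le, hz.2⟩
      · exact ⟨hxZ, hcx, hxy⟩
      · exact ⟨hw.1, hw.2.1, hw.2.2.trans hxy⟩
    have hle := Set.ncard_le_ncard hsub hfy
    rw [Set.ncard_insert_of_notMem (fun h => ?_) (hfx.insert x),
      Set.ncard_insert_of_notMem (fun h => h.2.2.false) hfx] at hle
    · omega
    · rcases h with rfl | h
      · exact hz.1.false
      · exact hz.1.not_gt h.2.2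
  · omega
  · refine ⟨hcx.trans_le hcy, fun z hz hzZ => ?_⟩
    have h1 : Z ∩ Set.Ioo x c = ∅ := by
      rw [← Set.ncard_eq_zero hfx]; omega
    have h2 : Z ∩ Set.Ico c y = ∅ := by
      rw [← Set.ncard_eq_zero hfy]; omega
    rcases lt_or_ge z c with h | h
    · exact h1.subset ⟨hzZ, hz.1, h⟩
    · exact h2.subset ⟨hzZ, h, hz.2⟩
  · have hxy : x < y := by
      by_contra! h
      have := Set.ncard_le_ncard
        (Set.inter_subset_inter_right Z (Set.Ioo_subset_Ioo_left h : Set.Ioo x c ⊆ Set.Ioo y c)) hfy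
      omega
    refine ⟨hxy, fun z hz hzZ => ?_⟩
    have hsub : insert z (insert y (Z ∩ Set.Ioo y c)) ⊆ Z ∩ Set.Ioo x c := by
      rintro w (rfl | rfl | hw)
      · exact ⟨hzZ, hz.1, hz.2.trans hcy⟩
      · exact ⟨hyZ, hxy, hcy⟩
      · exact ⟨hw.1, hxy.trans hw.2.1, hw.2.2⟩
    have hle := Set.ncard_le_ncard hsub hfx
    rw [Set.ncard_insert_of_notMem (fun h => ?_) (hfy.insert y),
      Set.ncard_insert_of_notMem (fun h => h.2.1.false) hfy] at hle
    · omega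
    · rcases h with rfl | h
      · exact hz.2.false
      · exact hz.2.not_gt h.2.1

/-- If more than `|n|` points lie within `δ` of `c` on either side, the `n`-th point around `c`
is within `δ` of `c`. -/
theorem IsNthPoint.abs_sub_le {Z : Set ℝ} {c δ : ℝ} {n : ℤ} {x : ℝ} (hx : IsNthPoint Z c n x)
    (hright : n.natAbs < (Z ∩ Set.Ioo c (c + δ)).ncard)
    (hleft : n.natAbs < (Z ∩ Set.Ioo (c - δ) c).ncard) : |x - c| ≤ δ := by
  obtain ⟨-, ⟨hn, hcx, hfx, hnx⟩ | ⟨hn, hcx, hfx, hnx⟩⟩ := hx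
  · rw [abs_of_nonneg (sub_nonneg.2 hcx)]
    by_contra! h
    have := Set.ncard_le_ncard (s := Z ∩ Set.Ioo c (c + δ)) (t := Z ∩ Set.Ico c x)
      (fun w hw => ⟨hw.1, hw.2.1.le, by linarith [hw.2.2]⟩) hfx
    omega
  · rw [abs_of_neg (sub_neg.2 hcx)]
    by_contra! h
    have := Set.ncard_le_ncard (s := Z ∩ Set.Ioo (c - δ) c) (t := Z ∩ Set.Ioo x c)
      (fun w hw => ⟨hw.1, by linarith [hw.2.1], hw.2.2⟩) hfx
    omega

/-- The tent function supported on `[p, q]`. -/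
noncomputable def tent (p q t : ℝ) : ℝ := max 0 (min (t - p) (q - t))

theorem continuous_tent (p q : ℝ) : Continuous (tent p q) := by
  unfold tent; fun_prop

theorem tent_pos {p q t : ℝ} (ht : t ∈ Set.Ioo p q) : 0 < tent p q t :=
  lt_max_of_lt_right (lt_min (sub_pos.2 ht.1) (sub_pos.2 ht.2))

theorem tent_eq_zero {p q t : ℝ} (ht : t ∉ Set.Ioo p q) : tent p q t = 0 := by
  refine max_eq_left ?_
  by_contra! h
  exact ht ⟨sub_pos.1 (h.trans_le (min_le_left _ _)), sub_pos.1 (h.trans_le (min_le_right _ _))⟩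

theorem tent_le {p q : ℝ} (hpq : p < q) (t : ℝ) : tent p q t ≤ q - p := by
  refine max_le (by linarith) ?_
  rcases le_total t q with h | h
  · exact (min_le_left _ _).trans (by linarith)
  · exact (min_le_right _ _).trans (by linarith)

theorem tsupport_tent_subset (p q : ℝ) : tsupport (tent p q) ⊆ Set.Icc p q :=
  closure_minimal
    (fun t ht => by
      by_contra h
      exact ht (tent_eq_zero fun h' => h (Set.Ioo_subset_Icc_self h')))
    isClosed_Icc

theorem hasCompactSupport_tent (p q : ℝ) : HasCompactSupport (tent p q) :=
  isCompact_Icc.of_isClosed_subset (isClosed_tsupport _) (tsupport_tent_subset p q)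

theorem integral_tent_mul_pos {ρ : ℝ → ℝ} (hρcont : ContinuousOn ρ (Set.Ioi 0))
    (hρpos : ∀ ξ > 0, 0 < ρ ξ) {p q : ℝ} (hp : 0 < p) (hpq : p < q) :
    0 < ∫ ξ in Set.Ioi (0 : ℝ), tent p q ξ * ρ ξ := by
  have hsub : Set.Ioc p q ⊆ Set.Ioi 0 := fun t ht => hp.trans ht.1
  rw [MeasureTheory.setIntegral_eq_of_subset_of_forall_sdiff_eq_zero measurableSet_Ioi hsub
    (fun t ht => by
      rw [tent_eq_zero fun h => ht.2 (Set.Ioo_subset_Ioc_self h), zero_mul]),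
    ← intervalIntegral.integral_of_le hpq.le]
  refine intervalIntegral.intervalIntegral_pos_of_pos_on ?_ ?_ hpq
  · refine ContinuousOn.intervalIntegrable ?_
    rw [Set.uIcc_of_le hpq.le]
    exact (continuous_tent p q).continuousOn.mul
      (hρcont.mono fun t ht => hp.trans_le ht.1)
  · exact fun t ht => mul_pos (tent_pos ht) (hρpos t (hp.trans ht.1))

/-- The sum of a tent function over a set is controlled by the number of points in its support. -/
theorem tsum_tent_le {Z : Set ℝ} {p q : ℝ} (hpq : p < q) (hfin : (Z ∩ Set.Ioo p q).Finite) :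
    ∑' ξ : Z, tent p q ξ ≤ (Z ∩ Set.Ioo p q).ncard * (q - p) := by
  classical
  rw [tsum_subtype Z (tent p q), tsum_eq_sum (s := hfin.toFinset)]
  · rw [Set.ncard_eq_toFinset_card _ hfin, ← nsmul_eq_mul]
    refine Finset.sum_le_card_nsmul _ _ _ fun t ht => ?_
    refine Set.indicator_apply_le' (fun _ => tent_le hpq t) fun _ => (sub_pos.2 hpq).le
  · intro t ht
    rw [Set.Finite.mem_toFinset] at ht
    by_cases htZ : t ∈ Z
    · rw [Set.indicator_of_mem htZ, tent_eq_zero fun h => ht ⟨htZ, h⟩]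
    · exact Set.indicator_of_notMem htZ _

/-- Weak convergence of the normalized counting measures to a measure with positive density forces
the number of points in a fixed interval to infinity. -/
theorem eventually_lt_ncard_inter_Ioo {Z : ℝ → Set ℝ} {ρ : ℝ → ℝ}
    (hρcont : ContinuousOn ρ (Set.Ioi 0)) (hρpos : ∀ ξ > 0, 0 < ρ ξ)
    (hlocfin : ∀ L : ℝ, 0 < L → ∀ K : Set ℝ, IsCompact K → (Z L ∩ K).Finite)
    (hdos : ∀ f : ℝ → ℝ, Continuous f → HasCompactSupport f → tsupport f ⊆ Set.Ioi 0 →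
      Filter.Tendsto (fun L : ℝ => (1 / L) * ∑' ξ : Z L, f ξ)
        Filter.atTop (nhds (∫ ξ in Set.Ioi (0 : ℝ), f ξ * ρ ξ)))
    {p q : ℝ} (hp : 0 < p) (hpq : p < q) (N : ℕ) :
    ∀ᶠ L in Filter.atTop, N < (Z L ∩ Set.Ioo p q).ncard := by
  have hI := integral_tent_mul_pos hρcont hρpos hp hpq
  have hlim := hdos (tent p q) (continuous_tent p q) (hasCompactSupport_tent p q)
    ((tsupport_tent_subset p q).trans fun t ht => hp.trans_le ht.1)
  filter_upwards [hlim.eventually_const_lt (half_lt_self hI), Filter.eventually_gt_atTop 0,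
    Filter.eventually_gt_atTop (N * (q - p) / ((∫ ξ in Set.Ioi (0 : ℝ), tent p q ξ * ρ ξ) / 2))]
    with L h1 h2 h3
  have hfin : (Z L ∩ Set.Ioo p q).Finite := (hlocfin L h2 (Set.Icc p q) isCompact_Icc).subset
    (Set.inter_subset_inter_right _ Set.Ioo_subset_Icc_self)
  rw [div_lt_iff₀ (half_pos hI)] at h3
  rw [one_div, inv_mul_eq_div, lt_div_iff₀ h2] at h1
  have h4 : (N : ℝ) * (q - p) < (Z L ∩ Set.Ioo p q).ncard * (q - p) := by
    linarith [tsum_tent_le hpq hfin]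
  exact_mod_cast lt_of_mul_lt_mul_right h4 (sub_pos.2 hpq).le

/-- Version of `eventually_lt_ncard_inter_Ioo` that is uniform over intervals of fixed length. -/
theorem eventually_forall_lt_ncard_inter_Ioo {Z : ℝ → Set ℝ} {ρ : ℝ → ℝ}
    (hρcont : ContinuousOn ρ (Set.Ioi 0)) (hρpos : ∀ ξ > 0, 0 < ρ ξ)
    (hlocfin : ∀ L : ℝ, 0 < L → ∀ K : Set ℝ, IsCompact K → (Z L ∩ K).Finite)
    (hdos : ∀ f : ℝ → ℝ, Continuous f → HasCompactSupport f → tsupport f ⊆ Set.Ioi 0 →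
      Filter.Tendsto (fun L : ℝ => (1 / L) * ∑' ξ : Z L, f ξ)
        Filter.atTop (nhds (∫ ξ in Set.Ioi (0 : ℝ), f ξ * ρ ξ)))
    {K : Set ℝ} (hK : IsCompact K) (hK0 : K ⊆ Set.Ioi 0) {δ : ℝ} (hδ : 0 < δ) (N : ℕ) :
    ∀ᶠ L in Filter.atTop, ∀ c ∈ K, N < (Z L ∩ Set.Ioo c (c + δ)).ncard := by
  refine hK.induction_on (p := fun s => ∀ᶠ L in Filter.atTop, ∀ c ∈ s,
    N < (Z L ∩ Set.Ioo c (c + δ)).ncard) (by simp) ?_ ?_ ?_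
  · exact fun s t hst ht => ht.mono fun L h c hc => h c (hst hc)
  · intro s t hs ht
    filter_upwards [hs, ht] with L h1 h2 c hc
    exact hc.elim (h1 c) (h2 c)
  · intro c hc
    have hc0 : 0 < c := hK0 hc
    refine ⟨Metric.ball c (δ / 3), mem_nhdsWithin_of_mem_nhds (Metric.ball_mem_nhds c (by linarith)),
      ?_⟩
    filter_upwards [eventually_lt_ncard_inter_Ioo hρcont hρpos hlocfin hdos
      (p := c + δ / 3) (q := c + 2 * δ / 3) (by linarith) (by linarith) N,
      Filter.eventually_gt_atTop 0] with L hL hL0 d hd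
    rw [Metric.mem_ball, Real.dist_eq, abs_lt] at hd
    refine hL.trans_le (Set.ncard_le_ncard
      (Set.inter_subset_inter_right _ (Set.Ioo_subset_Ioo (by linarith) (by linarith))) ?_)
    exact (hlocfin L hL0 (Set.Icc d (d + δ)) isCompact_Icc).subset
      (Set.inter_subset_inter_right _ Set.Ioo_subset_Icc_self)

/-- Grönwall bound for a second order linear equation with small inhomogeneity and zero initial
data. -/
theorem norm_deriv_le_gronwallBound {p q Q e : ℝ → ℂ} {L M ε : ℝ}
    (hp : ∀ x ∈ Set.Ici (0 : ℝ), HasDerivWithinAt p (q x) (Set.Ici 0) x)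
    (hq : ∀ x ∈ Set.Ici (0 : ℝ), HasDerivWithinAt q (Q x * p x + e x) (Set.Ici 0) x)
    (hp0 : p 0 = 0) (hq0 : q 0 = 0) (hQ : ∀ x ∈ Set.Icc 0 L, ‖Q x‖ ≤ M)
    (he : ∀ x ∈ Set.Icc 0 L, ‖e x‖ ≤ ε) (hL : 0 ≤ L) :
    ‖q L‖ ≤ gronwallBound 0 (max 1 M) ε L := by
  have hderiv : ∀ x ∈ Set.Ici (0 : ℝ),
      HasDerivWithinAt (fun x => (p x, q x)) (q x, Q x * p x + e x) (Set.Ici 0) x :=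
    fun x hx => (hp x hx).prodMk (hq x hx)
  have hmain := norm_le_gronwallBound_of_norm_deriv_right_le (δ := 0) (K := max 1 M) (ε := ε)
    (a := 0) (b := L) (f := fun x => (p x, q x)) (f' := fun x => (q x, Q x * p x + e x))
    (fun x hx => ((hderiv x hx.1).mono Set.Icc_subset_Ici_self).continuousWithinAt)
    (fun x hx => (hderiv x hx.1).mono (Set.Ici_subset_Ici.2 hx.1))
    (by simp [hp0, hq0]) ?_ L ⟨hL, le_rfl⟩
  · rw [sub_zero] at hmain
    exact (norm_snd_le (p L, q L)).trans hmain
  · intro x hx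
    have hx' := Set.Ico_subset_Icc_self hx
    have hε : 0 ≤ ε := (norm_nonneg _).trans (he x hx')
    have hM : 0 ≤ M := (norm_nonneg _).trans (hQ x hx')
    have h1 : ‖p x‖ ≤ ‖(p x, q x)‖ := norm_fst_le (p x, q x)
    refine max_le ?_ ?_
    · calc ‖q x‖ ≤ 1 * ‖(p x, q x)‖ + 0 := by simp
        _ ≤ _ := by gcongr; exact le_max_left _ _
    · calc ‖Q x * p x + e x‖ ≤ ‖Q x‖ * ‖p x‖ + ‖e x‖ := by
            simpa using norm_add_le (Q x * p x) (e x)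
        _ ≤ max 1 M * ‖(p x, q x)‖ + ε := by
            gcongr
            · exact (hQ x hx').trans (le_max_right _ _)
            · exact he x hx'

section Neumann

variable {V : ℝ → ℝ} {u u' : ℂ → ℝ → ℂ}

/-- For real spectral parameter the derivative of the Neumann solution is real. -/
theorem neumann_deriv_im_eq_zero (hV : ContinuousOn V (Set.Ici 0))
    (hu : ∀ ξ : ℂ, ∀ x ∈ Set.Ici (0 : ℝ), HasDerivWithinAt (u ξ) (u' ξ x) (Set.Ici 0) x)
    (hu' : ∀ ξ : ℂ, ∀ x ∈ Set.Ici (0 : ℝ),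
      HasDerivWithinAt (u' ξ) (((V x : ℂ) - ξ) * u ξ x) (Set.Ici 0) x)
    (hbc0 : ∀ ξ : ℂ, u ξ 0 = 1) (hbc1 : ∀ ξ : ℂ, u' ξ 0 = 0) (ξ : ℝ) {L : ℝ} (hL : 0 ≤ L) :
    (u' ξ L).im = 0 := by
  have hcont : ContinuousOn (fun x => (V x : ℂ) - ξ) (Set.Icc 0 L) :=
    (Complex.continuous_ofReal.comp_continuousOn
      (hV.mono Set.Icc_subset_Ici_self)).sub continuousOn_const
  obtain ⟨M, hM⟩ := isCompact_Icc.exists_bound_of_continuousOn hcont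
  have h := norm_deriv_le_gronwallBound (L := L) (M := M) (ε := 0)
    (p := fun x => u ξ x - star (u ξ x)) (q := fun x => u' ξ x - star (u' ξ x))
    (Q := fun x => (V x : ℂ) - ξ) (e := fun _ => 0)
    (fun x hx => (hu ξ x hx).sub (hu ξ x hx).star)
    (fun x hx => by
      refine ((hu' ξ x hx).sub (hu' ξ x hx).star).congr_deriv ?_
      simp
      ring)
    (by simp [hbc0]) (by simp [hbc1]) hM (by simp) hL
  rw [gronwallBound_ε0_δ0, norm_le_zero_iff, sub_eq_zero] at h
  exact Complex.conj_eq_iff_im.1 h.symm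

/-- The derivative of the Neumann solution at `L` depends continuously on the spectral
parameter. -/
theorem continuous_neumann_deriv (hV : ContinuousOn V (Set.Ici 0))
    (hu : ∀ ξ : ℂ, ∀ x ∈ Set.Ici (0 : ℝ), HasDerivWithinAt (u ξ) (u' ξ x) (Set.Ici 0) x)
    (hu' : ∀ ξ : ℂ, ∀ x ∈ Set.Ici (0 : ℝ),
      HasDerivWithinAt (u' ξ) (((V x : ℂ) - ξ) * u ξ x) (Set.Ici 0) x)
    (hbc0 : ∀ ξ : ℂ, u ξ 0 = 1) (hbc1 : ∀ ξ : ℂ, u' ξ 0 = 0) {L : ℝ} (hL : 0 ≤ L) :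
    Continuous fun ξ : ℂ => u' ξ L := by
  rw [continuous_iff_continuousAt]
  intro ξ
  have hcont : ContinuousOn (fun x => (V x : ℂ)) (Set.Icc 0 L) :=
    Complex.continuous_ofReal.comp_continuousOn (hV.mono Set.Icc_subset_Ici_self)
  obtain ⟨M, hM⟩ := isCompact_Icc.exists_bound_of_continuousOn hcont
  have hucont : ContinuousOn (u ξ) (Set.Icc 0 L) := fun x hx =>
    ((hu ξ x hx.1).mono Set.Icc_subset_Ici_self).continuousWithinAt
  obtain ⟨B, hB⟩ := isCompact_Icc.exists_bound_of_continuousOn hucont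
  have hbound : ∀ᶠ ζ in nhds ξ, dist (u' ζ L) (u' ξ L) ≤
      gronwallBound 0 (max 1 (M + (‖ξ‖ + 1))) (‖ζ - ξ‖ * B) L := by
    filter_upwards [Metric.ball_mem_nhds ξ one_pos] with ζ hζ
    rw [mem_ball_iff_norm] at hζ
    rw [dist_eq_norm]
    refine norm_deriv_le_gronwallBound
      (p := fun x => u ζ x - u ξ x) (q := fun x => u' ζ x - u' ξ x)
      (Q := fun x => (V x : ℂ) - ζ) (e := fun x => -((ζ - ξ) * u ξ x))
      (fun x hx => (hu ζ x hx).sub (hu ξ x hx)) (fun x hx => ?_)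
      (by simp [hbc0]) (by simp [hbc1]) (fun x hx => ?_) (fun x hx => ?_) hL
    · refine ((hu' ζ x hx).sub (hu' ξ x hx)).congr_deriv ?_
      ring
    · have h1 : ‖ζ‖ ≤ ‖ξ‖ + ‖ζ - ξ‖ := by
        simpa using norm_add_le ξ (ζ - ξ)
      exact (norm_sub_le _ _).trans (add_le_add (hM x hx) (by linarith))
    · rw [norm_neg, norm_mul]
      exact mul_le_mul_of_nonneg_left (hB x hx) (norm_nonneg _)
  have hK : max 1 (M + (‖ξ‖ + 1)) ≠ 0 := (lt_max_of_lt_left one_pos).ne'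
  rw [ContinuousAt, tendsto_iff_dist_tendsto_zero]
  refine squeeze_zero' (Filter.Eventually.of_forall fun _ => dist_nonneg) hbound ?_
  simp only [gronwallBound_of_K_ne_0 hK, zero_mul, zero_add]
  have : Continuous fun ζ : ℂ => ‖ζ - ξ‖ * B / max 1 (M + (‖ξ‖ + 1)) *
      (Real.exp (max 1 (M + (‖ξ‖ + 1)) * L) - 1) := by fun_prop
  simpa using this.tendsto ξ

/-- The Christoffel–Darboux formula. -/
theorem christoffel_darboux
    (hu : ∀ ξ : ℂ, ∀ x ∈ Set.Ici (0 : ℝ), HasDerivWithinAt (u ξ) (u' ξ x) (Set.Ici 0) x)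
    (hu' : ∀ ξ : ℂ, ∀ x ∈ Set.Ici (0 : ℝ),
      HasDerivWithinAt (u' ξ) (((V x : ℂ) - ξ) * u ξ x) (Set.Ici 0) x)
    (hbc1 : ∀ ξ : ℂ, u' ξ 0 = 0) (ξ ζ : ℂ) {L : ℝ} (hL : 0 ≤ L) :
    (ξ - ζ) * ∫ r in (0 : ℝ)..L, u ξ r * u ζ r = u ξ L * u' ζ L - u' ξ L * u ζ L := by
  have hd : ∀ x ∈ Set.Ici (0 : ℝ), HasDerivWithinAt (fun x => u ξ x * u' ζ x - u' ξ x * u ζ x)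
      ((ξ - ζ) * (u ξ x * u ζ x)) (Set.Ici 0) x := fun x hx =>
    (((hu ξ x hx).mul (hu' ζ x hx)).sub ((hu' ξ x hx).mul (hu ζ x hx))).congr_deriv (by ring)
  have hc : ∀ ξ : ℂ, ContinuousOn (u ξ) (Set.Icc 0 L) := fun ξ x hx =>
    ((hu ξ x hx.1).mono Set.Icc_subset_Ici_self).continuousWithinAt
  rw [← intervalIntegral.integral_const_mul,
    intervalIntegral.integral_eq_sub_of_hasDerivAt_of_le hL
      (fun x hx => ((hd x hx.1).mono Set.Icc_subset_Ici_self).continuousWithinAt)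
      (fun x hx => (hd x hx.1.le).hasDerivAt (Ici_mem_nhds hx.1))]
  · simp [hbc1]
  · refine ContinuousOn.intervalIntegrable ?_
    rw [Set.uIcc_of_le hL]
    exact continuousOn_const.mul ((hc ξ).mul (hc ζ))

/-- Suppose the Christoffel–Darboux kernel at a Neumann eigenvalue `x`, normalized by a
constant `s`, has positive real part at `z₁` and negative real part at `z₂ > z₁ > x`. Then there is
another Neumann eigenvalue in `[z₁, z₂]`. -/
theorem exists_neumann_eigenvalue_mem_Icc (hV : ContinuousOn V (Set.Ici 0))
    (hu : ∀ ξ : ℂ, ∀ x ∈ Set.Ici (0 : ℝ), HasDerivWithinAt (u ξ) (u' ξ x) (Set.Ici 0) x)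
    (hu' : ∀ ξ : ℂ, ∀ x ∈ Set.Ici (0 : ℝ),
      HasDerivWithinAt (u' ξ) (((V x : ℂ) - ξ) * u ξ x) (Set.Ici 0) x)
    (hbc0 : ∀ ξ : ℂ, u ξ 0 = 1) (hbc1 : ∀ ξ : ℂ, u' ξ 0 = 0) {L x z₁ z₂ : ℝ} {s : ℂ}
    (hL : 0 ≤ L) (hx : u' x L = 0) (h1 : x < z₁) (h2 : z₁ ≤ z₂)
    (hpos : 0 < ((∫ r in (0 : ℝ)..L, u x r * u z₁ r) / s).re)
    (hneg : ((∫ r in (0 : ℝ)..L, u x r * u z₂ r) / s).re < 0) :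
    ∃ z ∈ Set.Icc z₁ z₂, u' z L = 0 := by
  have him := neumann_deriv_im_eq_zero hV hu hu' hbc0 hbc1 (hL := hL)
  have hreal : ∀ z : ℝ, u' z L = ((u' z L).re : ℂ) := fun z =>
    Complex.ext rfl (by simp [him z])
  have hF : Continuous fun z : ℝ => (u' z L).re :=
    Complex.continuous_re.comp
      ((continuous_neumann_deriv hV hu hu' hbc0 hbc1 hL).comp Complex.continuous_ofReal)
  have hmul : ∀ z : ℝ, (x - z) * ((∫ r in (0 : ℝ)..L, u x r * u z r) / s).re =
      (u x L / s).re * (u' z L).re := by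
    intro z
    have h := christoffel_darboux hu hu' hbc1 x z hL
    rw [hx, zero_mul, sub_zero, hreal z] at h
    have h' : ((x - z : ℝ) : ℂ) * ((∫ r in (0 : ℝ)..L, u x r * u z r) / s) =
        (u x L / s) * ((u' z L).re : ℂ) := by
      push_cast
      rw [← mul_div_assoc, h]
      ring
    simpa only [Complex.re_ofReal_mul, Complex.re_mul_ofReal] using congrArg Complex.re h'
  have hz₁ := hmul z₁
  have hz₂ := hmul z₂
  have hn : (u x L / s).re * (u' z₁ L).re < 0 := by
    rw [← hz₁]; exact mul_neg_of_neg_of_pos (by linarith) hpos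
  have hp : 0 < (u x L / s).re * (u' z₂ L).re := by
    rw [← hz₂]; exact mul_pos_of_neg_of_neg (by linarith) hneg
  obtain ⟨z, hz, hz0⟩ := intermediate_value_Icc h2
    (continuous_const.mul hF : Continuous fun z : ℝ => (u x L / s).re * (u' z L).re).continuousOn
    ⟨hn.le, hp.le⟩
  refine ⟨z, hz, ?_⟩
  have hκ : (u x L / s).re ≠ 0 := left_ne_zero_of_mul hn.ne
  have hre : (u' z L).re = 0 := (mul_eq_zero.1 hz0).resolve_left hκ
  rw [hreal z, hre, Complex.ofReal_zero]

/-- If the normalized Christoffel–Darboux kernel at a Neumann eigenvalue `x` is close to the sine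
kernel, the rescaled distance from `x` to the next Neumann eigenvalue `y` is close to `1`. -/
theorem abs_rescaled_gap_sub_one_le (hV : ContinuousOn V (Set.Ici 0))
    (hu : ∀ ξ : ℂ, ∀ x ∈ Set.Ici (0 : ℝ), HasDerivWithinAt (u ξ) (u' ξ x) (Set.Ici 0) x)
    (hu' : ∀ ξ : ℂ, ∀ x ∈ Set.Ici (0 : ℝ),
      HasDerivWithinAt (u' ξ) (((V x : ℂ) - ξ) * u ξ x) (Set.Ici 0) x)
    (hbc0 : ∀ ξ : ℂ, u ξ 0 = 1) (hbc1 : ∀ ξ : ℂ, u' ξ 0 = 0) {L x y d ε η : ℝ} {s : ℂ}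
    (hL : 0 < L) (hd : 0 < d) (hε : 0 < ε) (hε1 : ε ≤ 1 / 2)
    (hη : ∀ t ∈ Set.Icc 0 (π * (1 - ε)), η ≤ Real.sinc t)
    (hη' : η ≤ -Real.sinc (π * (1 + ε)))
    (hker : ∀ t ∈ Set.Icc 0 2,
      |((∫ r in (0 : ℝ)..L, u x r * u ((x + t / (d * L) : ℝ) : ℂ) r) / s).re -
        Real.sinc (π * t)| < η)
    (hx : u' x L = 0) (hy : u' y L = 0) (hxy : x < y)
    (hgap : ∀ z ∈ Set.Ioo x y, u' z L ≠ 0) :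
    |L * (y - x) * d - 1| ≤ ε := by
  have hdL : 0 < d * L := mul_pos hd hL
  have hupper : y ≤ x + (1 + ε) / (d * L) := by
    have h1 := hker (1 / 2) (by norm_num)
    have h2 := hker (1 + ε) ⟨by linarith, by linarith⟩
    have h3 := hη (π * (1 / 2)) ⟨by positivity, by gcongr; linarith⟩
    obtain ⟨z, hz, hz0⟩ := exists_neumann_eigenvalue_mem_Icc hV hu hu' hbc0 hbc1 (s := s)
      (z₁ := x + 1 / 2 / (d * L)) (z₂ := x + (1 + ε) / (d * L)) hL.le hx
      (by linarith [div_pos one_half_pos hdL]) (by gcongr; linarith)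
      (by linarith [(abs_lt.1 h1).1]) (by linarith [(abs_lt.1 h2).2])
    by_contra! h
    exact hgap z ⟨by linarith [hz.1, div_pos one_half_pos hdL], hz.2.trans_lt h⟩ hz0
  have hle : L * (y - x) * d ≤ 1 + ε := by
    have := (le_div_iff₀ hdL).1 (sub_le_iff_le_add'.2 hupper)
    linarith
  have hge : 1 - ε ≤ L * (y - x) * d := by
    by_contra! h
    have h0 : 0 ≤ L * (y - x) * d :=
      mul_nonneg (mul_nonneg hL.le (sub_pos.2 hxy).le) hd.le
    have h1 := hker (L * (y - x) * d) ⟨h0, by linarith⟩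
    have hyeq : x + L * (y - x) * d / (d * L) = y := by
      field_simp
      ring
    have hCD := christoffel_darboux hu hu' hbc1 x y hL.le
    rw [hx, hy, mul_zero, zero_mul, sub_zero, mul_eq_zero, sub_eq_zero] at hCD
    rw [hyeq, hCD.resolve_left (by exact_mod_cast hxy.ne), zero_div, Complex.zero_re] at h1
    have h2 := hη (π * (L * (y - x) * d)) ⟨by positivity, by gcongr⟩
    linarith [(abs_lt.1 h1).1]
  rw [abs_le]
  constructor <;> linarith

end Neumann

/-- The Freud–Levin theorem in the continuum setting: sine-kernel asymptotics for the
Christoffel–Darboux kernel, together with convergence of the normalized eigenvalue counting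
measures to an absolutely continuous density of states `ρ`, imply uniform clock behavior on
every compact interval `I ⊂ (0,∞)`. -/
theorem sine_kernel_implies_clock (V : ℝ → ℝ) (hV : ContinuousOn V (Set.Ici 0))
    (u u' : ℂ → ℝ → ℂ)
    (hu : ∀ ξ : ℂ, ∀ x ∈ Set.Ici (0 : ℝ), HasDerivWithinAt (u ξ) (u' ξ x) (Set.Ici 0) x)
    (hu' : ∀ ξ : ℂ, ∀ x ∈ Set.Ici (0 : ℝ),
      HasDerivWithinAt (u' ξ) (((V x : ℂ) - ξ) * u ξ x) (Set.Ici 0) x)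
    (hbc0 : ∀ ξ : ℂ, u ξ 0 = 1) (hbc1 : ∀ ξ : ℂ, u' ξ 0 = 0)
    (ρ : ℝ → ℝ) (hρcont : ContinuousOn ρ (Set.Ioi 0)) (hρpos : ∀ ξ > 0, 0 < ρ ξ)
    -- (i) sine-kernel asymptotics, uniformly on compacts of `(0,∞)` and of the strip
    (hsine : ∀ K : Set ℝ, IsCompact K → K ⊆ Set.Ioi 0 →
      ∀ K' : Set ℂ, IsCompact K' → K' ⊆ {z : ℂ | |z.im| ≤ 1} →
      TendstoUniformlyOn
        (fun (L : ℝ) (p : ℝ × ℂ × ℂ) =>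
          (∫ r in (0 : ℝ)..L, u ((p.1 : ℂ) + p.2.1 / L) r * u ((p.1 : ℂ) + p.2.2 / L) r) /
            ∫ r in (0 : ℝ)..L, u (p.1 : ℂ) r * u (p.1 : ℂ) r)
        (fun p => csinc ((π * ρ p.1 : ℝ) * (p.2.2 - p.2.1)))
        Filter.atTop (K ×ˢ K' ×ˢ K'))
    -- (ii) the sets `Z_L` are discrete and the normalized counting measures converge
    -- vaguely to `ρ(ξ) dξ` on `(0,∞)`
    (hdiscrete : ∀ L : ℝ, 0 < L → DiscreteTopology ({ξ : ℝ | u' (ξ : ℂ) L = 0} : Set ℝ))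
    (hlocfin : ∀ L : ℝ, 0 < L → ∀ K : Set ℝ, IsCompact K →
      ({ξ : ℝ | u' (ξ : ℂ) L = 0} ∩ K).Finite)
    (hdos : ∀ f : ℝ → ℝ, Continuous f → HasCompactSupport f → tsupport f ⊆ Set.Ioi 0 →
      Filter.Tendsto
        (fun L : ℝ => (1 / L) * ∑' ξ : ({ξ : ℝ | u' (ξ : ℂ) L = 0} : Set ℝ), f ξ)
        Filter.atTop (nhds (∫ ξ in Set.Ioi (0 : ℝ), f ξ * ρ ξ))) :
    -- conclusion: uniform clock behavior on every compact interval `[a,b] ⊂ (0,∞)`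
    ∀ a b : ℝ, 0 < a → a ≤ b → ∀ n : ℤ, ∀ ε : ℝ, 0 < ε →
      ∃ L₀ : ℝ, ∀ L : ℝ, L₀ ≤ L → ∀ ξs ∈ Set.Icc a b, ∀ x y : ℝ,
        IsNthPoint {ξ : ℝ | u' (ξ : ℂ) L = 0} ξs n x →
        IsNthPoint {ξ : ℝ | u' (ξ : ℂ) L = 0} ξs (n + 1) y →
        |L * (y - x) * ρ ξs - 1| < ε := by
  intro a b ha hab n ε hε
  have hK0 : Set.Icc (a / 2) (b + a / 2) ⊆ Set.Ioi 0 := fun t ht => (half_pos ha).trans_le ht.1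
  have hρK := hρcont.mono hK0
  obtain ⟨m, hm, hmρ⟩ := isCompact_Icc.exists_forall_le' hρK fun t ht => hρpos t (hK0 ht)
  obtain ⟨ε₁, hε₁, hε₁half, hε₁ε⟩ : ∃ ε₁ : ℝ, 0 < ε₁ ∧ ε₁ ≤ 1 / 2 ∧ 3 * ε₁ < ε :=
    ⟨min (1 / 2) (ε / 4), by positivity, min_le_left _ _, by
      linarith [min_le_right (1 / 2) (ε / 4)]⟩
  obtain ⟨μ, hμ, hμsinc⟩ := exists_pos_le_sinc hε₁
  have hsneg := sinc_pi_mul_one_add_neg hε₁ (by linarith)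
  obtain ⟨δ₀, hδ₀, hδ₀ρ⟩ := Metric.uniformContinuousOn_iff.1
    (isCompact_Icc.uniformContinuousOn_of_continuous hρK) (ε₁ * m) (by positivity)
  obtain ⟨δ, hδ, hδδ₀, hδa⟩ : ∃ δ : ℝ, 0 < δ ∧ δ < δ₀ ∧ δ ≤ a / 2 :=
    ⟨min (δ₀ / 2) (a / 2), by positivity, (min_le_left _ _).trans_lt (half_lt_self hδ₀),
      min_le_right _ _⟩
  have hcount := eventually_forall_lt_ncard_inter_Ioo hρcont hρpos hlocfin hdos
    isCompact_Icc hK0 hδ n.natAbs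
  have hker := Metric.tendstoUniformlyOn_iff.1 (hsine _ isCompact_Icc hK0
    ((fun t : ℝ => (t : ℂ)) '' Set.Icc 0 (2 / m))
    (isCompact_Icc.image Complex.continuous_ofReal)
    (by rintro _ ⟨t, -, rfl⟩; simp))
    (min μ (-Real.sinc (π * (1 + ε₁)))) (lt_min hμ (neg_pos.2 hsneg))
  obtain ⟨L₀, hL₀⟩ := Filter.eventually_atTop.1
    ((hcount.and hker).and (Filter.eventually_gt_atTop 0))
  refine ⟨L₀, fun L hL ξs hξs x y hx hy => ?_⟩
  obtain ⟨⟨hcL, hkL⟩, hLpos⟩ := hL₀ L hL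
  have hxξ : |x - ξs| ≤ δ := by
    refine hx.abs_sub_le (hcL ξs ⟨by linarith [hξs.1], by linarith [hξs.2]⟩) ?_
    simpa using hcL (ξs - δ) ⟨by linarith [hξs.1], by linarith [hξs.2]⟩
  have hxK : x ∈ Set.Icc (a / 2) (b + a / 2) := by
    have := abs_le.1 hxξ
    exact ⟨by linarith [hξs.1], by linarith [hξs.2]⟩
  obtain ⟨hxy, hgap⟩ := hx.lt_and_forall_notMem hy
  have hρx : 0 < ρ x := hρpos x (hK0 hxK)
  have hclock := abs_rescaled_gap_sub_one_le hV hu hu' hbc0 hbc1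
    (s := ∫ r in (0 : ℝ)..L, u (x : ℂ) r * u (x : ℂ) r)
    hLpos hρx hε₁ hε₁half (fun t ht => (min_le_left _ _).trans (hμsinc t ht)) (min_le_right _ _)
    (fun t ht => ?_) hx.1 hy.1 hxy hgap
  · have hρξ : |ρ ξs - ρ x| < ε₁ * m := by
      refine hδ₀ρ ξs ⟨by linarith [hξs.1], by linarith [hξs.2]⟩ x hxK ?_
      rw [dist_comm, Real.dist_eq]
      linarith
    have hratio : |ρ ξs / ρ x - 1| ≤ ε₁ := by
      rw [div_sub_one hρx.ne', abs_div, abs_of_pos hρx, div_le_iff₀ hρx]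
      exact hρξ.le.trans (mul_le_mul_of_nonneg_left (hmρ x hxK) hε₁.le)
    have hsplit : L * (y - x) * ρ ξs - 1 = (L * (y - x) * ρ x - 1) * (ρ ξs / ρ x - 1) +
        (L * (y - x) * ρ x - 1) + (ρ ξs / ρ x - 1) := by
      field_simp
      ring
    rw [hsplit]
    refine (abs_add_three _ _ _).trans_lt ?_
    rw [abs_mul]
    have : |L * (y - x) * ρ x - 1| * |ρ ξs / ρ x - 1| ≤ ε₁ * ε₁ := by gcongr
    nlinarith
  · have h := hkL (x, ((0 : ℝ) : ℂ), ((t / ρ x : ℝ) : ℂ))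
      ⟨hxK, ⟨0, ⟨le_rfl, by positivity⟩, rfl⟩,
        ⟨t / ρ x, ⟨div_nonneg ht.1 hρx.le, div_le_div₀ zero_le_two ht.2 hm (hmρ x hxK)⟩, rfl⟩⟩
    have harg : ((π * ρ x : ℝ) : ℂ) * (((t / ρ x : ℝ) : ℂ) - ((0 : ℝ) : ℂ)) =
        ((π * t : ℝ) : ℂ) := by
      rw [← Complex.ofReal_sub, ← Complex.ofReal_mul]
      congr 1
      field_simp
      ring
    have hpt : (x : ℂ) + ((t / ρ x : ℝ) : ℂ) / L = ((x + t / (ρ x * L) : ℝ) : ℂ) := by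
      push_cast
      rw [div_div]
    rw [dist_comm, dist_eq_norm] at h
    dsimp only at h
    rw [harg, csinc_ofReal, hpt, Complex.ofReal_zero, zero_div, add_zero] at h
    refine lt_of_le_of_lt ?_ h
    simpa only [Complex.sub_re, Complex.ofReal_re] using Complex.abs_re_le_norm
      ((∫ r in (0 : ℝ)..L, u (x : ℂ) r * u ((x + t / (ρ x * L) : ℝ) : ℂ) r) /
        (∫ r in (0 : ℝ)..L, u (x : ℂ) r * u (x : ℂ) r) - (Real.sinc (π * t) : ℂ))
end

section
/- Let V : [0,∞) → ℝ be continuous, let u(ξ,·) be the Neumann solution of −∂ₓ²u + V·u = ξ·u, and let S_L(ξ,ζ) = ∫₀^L u(ξ,r)·u(ζ,r) dr. Let ξ, ζ ∈ ℝ with ξ ≠ ζ and L > 0. If ∂ₓu(ξ,L) = 0, then S_L(ξ,ζ) = 0 if and only if ∂ₓu(ζ,L) = 0. -/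
open Set in
/-- A solution of the first-order system `u' = p`, `p' = q u` with `q` continuous on `[0, L]`
that vanishes at `L` also vanishes at `0`. -/
theorem eq_zero_of_linear_ode_eq_zero {q u p : ℝ → ℝ} {L : ℝ} (hL : 0 ≤ L)
    (hq : ContinuousOn q (Icc 0 L)) (hu : ContinuousOn u (Icc 0 L))
    (hp : ContinuousOn p (Icc 0 L)) (hu' : ∀ x ∈ Ioo 0 L, HasDerivAt u (p x) x)
    (hp' : ∀ x ∈ Ioo 0 L, HasDerivAt p (q x * u x) x) (huL : u L = 0) (hpL : p L = 0) :
    u 0 = 0 ∧ p 0 = 0 := by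
  obtain ⟨C, hC⟩ := isCompact_Icc.exists_bound_of_continuousOn hq
  have hmono : MonotoneOn (fun x => (u x ^ 2 + p x ^ 2) * Real.exp ((1 + C) * x)) (Icc 0 L) := by
    have hder : ∀ x ∈ Ioo 0 L,
        HasDerivAt (fun x => (u x ^ 2 + p x ^ 2) * Real.exp ((1 + C) * x))
          ((2 * (1 + q x) * (u x * p x) + (1 + C) * (u x ^ 2 + p x ^ 2)) *
            Real.exp ((1 + C) * x)) x := by
      intro x hx
      have h := (((hu' x hx).pow 2).add ((hp' x hx).pow 2)).mul
        (((hasDerivAt_id x).const_mul (1 + C)).exp)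
      refine h.congr_deriv ?_
      simp
      ring
    refine monotoneOn_of_deriv_nonneg (convex_Icc 0 L) (by fun_prop) ?_ ?_
    · rw [interior_Icc]
      exact fun x hx => (hder x hx).differentiableAt.differentiableWithinAt
    · rw [interior_Icc]
      intro x hx
      rw [(hder x hx).deriv]
      refine mul_nonneg ?_ (Real.exp_pos _).le
      have hb := abs_le.mp (hC x (Ioo_subset_Icc_self hx))
      nlinarith [mul_nonneg (show 0 ≤ C - q x by linarith) (sq_nonneg (u x - p x)),
        mul_nonneg (show 0 ≤ 2 + C + q x by linarith)
          (sq_nonneg (u x + p x))]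
  have h := hmono (left_mem_Icc.mpr hL) (right_mem_Icc.mpr hL) hL
  simp only [huL, hpL, mul_zero, Real.exp_zero, mul_one] at h
  constructor <;> nlinarith [sq_nonneg (u 0), sq_nonneg (p 0)]

open Set in
/-- The continuous Christoffel–Darboux formula: Lagrange's identity for two solutions of
`-u'' + V u = ξ u` and `-v'' + V v = ζ v` with Neumann condition at `0`. -/
theorem christoffel_darboux_formula {V u p v w : ℝ → ℝ} {ξ ζ L : ℝ} (hL : 0 ≤ L)
    (hu : ContinuousOn u (Icc 0 L)) (hp : ContinuousOn p (Icc 0 L))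
    (hv : ContinuousOn v (Icc 0 L)) (hw : ContinuousOn w (Icc 0 L))
    (hu' : ∀ x ∈ Ioo 0 L, HasDerivAt u (p x) x)
    (hp' : ∀ x ∈ Ioo 0 L, HasDerivAt p ((V x - ξ) * u x) x)
    (hv' : ∀ x ∈ Ioo 0 L, HasDerivAt v (w x) x)
    (hw' : ∀ x ∈ Ioo 0 L, HasDerivAt w ((V x - ζ) * v x) x)
    (hp0 : p 0 = 0) (hw0 : w 0 = 0) :
    (ξ - ζ) * ∫ r in (0 : ℝ)..L, u r * v r = u L * w L - p L * v L := by
  have hint : IntervalIntegrable (fun r => (ξ - ζ) * (u r * v r)) MeasureTheory.volume 0 L := by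
    apply ContinuousOn.intervalIntegrable
    rw [uIcc_of_le hL]
    fun_prop
  have h := intervalIntegral.integral_eq_sub_of_hasDerivAt_of_le hL
    (f := fun x => u x * w x - p x * v x) (by fun_prop)
    (fun x hx => (((hu' x hx).mul (hw' x hx)).sub ((hp' x hx).mul (hv' x hx))).congr_deriv
      (show _ = (ξ - ζ) * (u x * v x) by ring)) hint
  rw [intervalIntegral.integral_const_mul] at h
  simpa [hp0, hw0] using h

/-- If `u(ξ,·)` is the Neumann solution of `-∂ₓ²u + V u = ξ u` and
`S_L(ξ,ζ) = ∫₀^L u(ξ,r) u(ζ,r) dr`, then for `ξ ≠ ζ` with `∂ₓu(ξ,L) = 0` one has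
`S_L(ξ,ζ) = 0` iff `∂ₓu(ζ,L) = 0`. -/
theorem CD_kernel_zero_iff (V : ℝ → ℝ) (hV : ContinuousOn V (Set.Ici 0))
    (u ux : ℝ → ℝ → ℝ)
    (hu : ∀ ξ : ℝ, ∀ x ∈ Set.Ici (0 : ℝ), HasDerivWithinAt (u ξ) (ux ξ x) (Set.Ici 0) x)
    (hux : ∀ ξ : ℝ, ∀ x ∈ Set.Ici (0 : ℝ),
      HasDerivWithinAt (ux ξ) ((V x - ξ) * u ξ x) (Set.Ici 0) x)
    (hbc0 : ∀ ξ : ℝ, u ξ 0 = 1) (hbc1 : ∀ ξ : ℝ, ux ξ 0 = 0)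
    (ξ ζ : ℝ) (hne : ξ ≠ ζ) (L : ℝ) (hL : 0 < L) (hξL : ux ξ L = 0) :
    (∫ r in (0 : ℝ)..L, u ξ r * u ζ r) = 0 ↔ ux ζ L = 0 := by
  have hsub : Set.Icc 0 L ⊆ Set.Ici (0 : ℝ) := Set.Icc_subset_Ici_self
  have cu (η : ℝ) : ContinuousOn (u η) (Set.Icc 0 L) :=
    ContinuousOn.mono (fun x hx => (hu η x hx).continuousWithinAt) hsub
  have cux (η : ℝ) : ContinuousOn (ux η) (Set.Icc 0 L) :=
    ContinuousOn.mono (fun x hx => (hux η x hx).continuousWithinAt) hsub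
  have du (η : ℝ) : ∀ x ∈ Set.Ioo 0 L, HasDerivAt (u η) (ux η x) x :=
    fun x hx => (hu η x hx.1.le).hasDerivAt (Ici_mem_nhds hx.1)
  have dux (η : ℝ) : ∀ x ∈ Set.Ioo 0 L, HasDerivAt (ux η) ((V x - η) * u η x) x :=
    fun x hx => (hux η x hx.1.le).hasDerivAt (Ici_mem_nhds hx.1)
  have hξ : u ξ L ≠ 0 := fun h0 => by
    have h := (eq_zero_of_linear_ode_eq_zero hL.le ((hV.mono hsub).sub continuousOn_const)
      (cu ξ) (cux ξ) (du ξ) (dux ξ) h0 hξL).1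
    exact one_ne_zero ((hbc0 ξ).symm.trans h)
  have key := christoffel_darboux_formula hL.le (cu ξ) (cux ξ) (cu ζ) (cux ζ) (du ξ) (dux ξ)
    (du ζ) (dux ζ) (hbc1 ξ) (hbc1 ζ)
  rw [hξL, zero_mul, sub_zero] at key
  rw [← mul_eq_zero_iff_left (sub_ne_zero.mpr hne), key, mul_eq_zero_iff_left hξ]
end

section
/- Let I = [a,b] ⊂ (0,∞) be a compact interval and W : ℝ → ℝ a smooth, nonnegative function with support contained in [0,1]. Then there exists a constant C > 0, depending only on I and W, such that the following holds: for every N > 0, every continuous V : [0,∞) → ℝ with V(x) = 0 for all x ≥ N, every ξ ∈ I, every λ ∈ ℝ with |λ| ≤ 1, and every pair of twice continuously differentiable functions u, v : [0,∞) → ℝ satisfying −u''(x) + V(x)·u(x) = ξ·u(x) and −v''(x) + (V(x) + λ·W(x − N))·v(x) = ξ·v(x) with u(0) = v(0) = 1 and u'(0) = v'(0) = 0, one has, for all x ≥ 0, ‖(v(x), v'(x)) − (u(x), u'(x))‖ ≤ C·|λ|·‖(u(x), u'(x))‖, where ‖·‖ is the Euclidean norm on ℝ². -/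
/-- A scalar Grönwall inequality: `E' ≤ K (E + c)` forces `E + c` to grow at most like
`exp (K x)`. -/
theorem add_const_le_exp_mul_of_deriv_le {E E' : ℝ → ℝ} {K c p q : ℝ} (hpq : p ≤ q)
    (hc : ContinuousOn E (Set.Icc p q))
    (hd : ∀ x ∈ Set.Ioo p q, HasDerivAt E (E' x) x)
    (hle : ∀ x ∈ Set.Ioo p q, E' x ≤ K * (E x + c)) :
    E q + c ≤ Real.exp (K * (q - p)) * (E p + c) := by
  have hG : AntitoneOn (fun x => Real.exp (-(K * (x - p))) * (E x + c)) (Set.Icc p q) := by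
    refine antitoneOn_of_hasDerivWithinAt_nonpos (convex_Icc p q)
      (f' := fun x => Real.exp (-(K * (x - p))) * (E' x - K * (E x + c))) ?_ ?_ ?_
    · exact ContinuousOn.mul (by fun_prop) (hc.add continuousOn_const)
    · intro x hx
      rw [interior_Icc] at hx
      have h1 : HasDerivAt (fun x => -(K * (x - p))) (-(K * 1)) x :=
        (((hasDerivAt_id x).sub_const p).const_mul K).neg
      exact ((h1.exp.mul ((hd x hx).add_const c)).congr_deriv (by ring)).hasDerivWithinAt
    · intro x hx
      rw [interior_Icc] at hx
      exact mul_nonpos_of_nonneg_of_nonpos (Real.exp_pos _).le (sub_nonpos.2 (hle x hx))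
  have h := hG (Set.left_mem_Icc.2 hpq) (Set.right_mem_Icc.2 hpq) hpq
  simp only [sub_self, mul_zero, neg_zero, Real.exp_zero, one_mul] at h
  calc E q + c
      = Real.exp (K * (q - p)) * (Real.exp (-(K * (q - p))) * (E q + c)) := by
        rw [← mul_assoc, ← Real.exp_add, add_neg_cancel, Real.exp_zero, one_mul]
    _ ≤ _ := mul_le_mul_of_nonneg_left h (Real.exp_pos _).le

/-- The derivative of the energy `ξ f² + f'²`. -/
theorem hasDerivWithinAt_energy {f f' : ℝ → ℝ} {ξ g x : ℝ} {s : Set ℝ}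
    (h : HasDerivWithinAt f (f' x) s x) (h' : HasDerivWithinAt f' g s x) :
    HasDerivWithinAt (fun y => ξ * f y ^ 2 + f' y ^ 2) (2 * f' x * (ξ * f x + g)) s x :=
  (((h.pow 2).const_mul ξ).add (h'.pow 2)).congr_deriv (by push_cast; ring)

/-- The energy controls the Euclidean norm. -/
theorem sq_add_sq_le_energy {a ξ : ℝ} (ha : 0 < a) (hξ : a ≤ ξ) (y z : ℝ) :
    y ^ 2 + z ^ 2 ≤ (1 + 1 / a) * (ξ * y ^ 2 + z ^ 2) := by
  have h1 : y ^ 2 ≤ 1 / a * (ξ * y ^ 2) := by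
    rw [one_div, inv_mul_eq_div, le_div_iff₀ ha, mul_comm]
    exact mul_le_mul_of_nonneg_right hξ (sq_nonneg y)
  have h2 : 0 ≤ 1 / a * z ^ 2 := by positivity
  have h3 : 0 ≤ ξ * y ^ 2 := mul_nonneg (ha.le.trans hξ) (sq_nonneg y)
  linarith

theorem two_mul_mul_le_of_abs_le {B c : ℝ} (hc : |c| ≤ B) (y z : ℝ) :
    2 * z * (c * y) ≤ B * (y ^ 2 + z ^ 2) := by
  obtain ⟨h1, h2⟩ := abs_le.1 hc
  nlinarith [mul_nonneg (sub_nonneg.2 h2) (sq_nonneg (y + z)),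
    mul_nonneg (neg_le_iff_add_nonneg'.1 h1) (sq_nonneg (y - z))]


/-- Lemma 2.8 (first inequality): adding a sparse bump `λ·W(x−N)` beyond the support of `V`
changes the Neumann solution `(u, u')` by at most `C·|λ|·‖(u(x),u'(x))‖` in Euclidean norm,
with `C` depending only on the compact interval `[a,b] ⊂ (0,∞)` and on `W`. -/
theorem sparse_perturbation_solution_bound (a b : ℝ) (ha : 0 < a) (hab : a ≤ b)
    (W : ℝ → ℝ) (hWsmooth : ContDiff ℝ (⊤ : ℕ∞) W) (hWnonneg : ∀ x, 0 ≤ W x)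
    (hWsupp : Function.support W ⊆ Set.Icc 0 1) :
    ∃ C : ℝ, 0 < C ∧ ∀ N : ℝ, 0 < N →
      ∀ V : ℝ → ℝ, ContinuousOn V (Set.Ici 0) → (∀ x, N ≤ x → V x = 0) →
      ∀ ξ ∈ Set.Icc a b, ∀ lam : ℝ, |lam| ≤ 1 →
      ∀ u u' v v' : ℝ → ℝ,
        (∀ x ∈ Set.Ici (0 : ℝ), HasDerivWithinAt u (u' x) (Set.Ici 0) x) →
        (∀ x ∈ Set.Ici (0 : ℝ),
          HasDerivWithinAt u' ((V x - ξ) * u x) (Set.Ici 0) x) →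
        (∀ x ∈ Set.Ici (0 : ℝ), HasDerivWithinAt v (v' x) (Set.Ici 0) x) →
        (∀ x ∈ Set.Ici (0 : ℝ),
          HasDerivWithinAt v' ((V x + lam * W (x - N) - ξ) * v x) (Set.Ici 0) x) →
        u 0 = 1 → v 0 = 1 → u' 0 = 0 → v' 0 = 0 →
        ∀ x : ℝ, 0 ≤ x →
          Real.sqrt ((v x - u x) ^ 2 + (v' x - u' x) ^ 2) ≤
            C * |lam| * Real.sqrt ((u x) ^ 2 + (u' x) ^ 2) := by
  obtain ⟨M, hM⟩ := (isCompact_Icc (a := (0 : ℝ)) (b := 1)).exists_bound_of_continuousOn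
    hWsmooth.continuous.continuousOn
  simp only [Real.norm_eq_abs] at hM
  have hM0 : 0 ≤ M := (abs_nonneg _).trans (hM 0 (by simp))
  have hW0 : ∀ y, y ∉ Set.Icc (0 : ℝ) 1 → W y = 0 := fun y hy =>
    Function.notMem_support.1 fun h => hy (hWsupp h)
  have ha' : 0 < 1 + 1 / a := by positivity
  have hb : 0 < 1 + b := by linarith
  set K := 2 * M * (1 + 1 / a) with hK
  refine ⟨Real.sqrt ((1 + 1 / a) * (Real.exp K * (1 + b))), by positivity, ?_⟩
  intro N hN V hVc hV ξ hξ lam hlam u u' v v' hu hu' hv hv' hu0 hv0 hu0' hv0' x hx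
  have hξ0 : 0 < ξ := ha.trans_le hξ.1
  set Eu : ℝ → ℝ := fun y => ξ * u y ^ 2 + u' y ^ 2 with hEu
  set Ew : ℝ → ℝ := fun y => ξ * (v y - u y) ^ 2 + (v' y - u' y) ^ 2 with hEw
  have hEu0 : ∀ y, 0 ≤ Eu y := fun y => by simp only [hEu]; positivity
  have hdu : ∀ y ∈ Set.Ici (0 : ℝ), HasDerivWithinAt Eu
      (2 * u' y * (V y * u y)) (Set.Ici 0) y := fun y hy =>
    (hasDerivWithinAt_energy (hu y hy) (hu' y hy)).congr_deriv (by ring)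
  have hdw : ∀ y ∈ Set.Ici (0 : ℝ), HasDerivWithinAt Ew
      (2 * (v' y - u' y) * (V y * (v y - u y)) +
        2 * (v' y - u' y) * (lam * W (y - N) * v y)) (Set.Ici 0) y := fun y hy =>
    (hasDerivWithinAt_energy (f := fun y => v y - u y) (f' := fun y => v' y - u' y)
      ((hv y hy).sub (hu y hy)) ((hv' y hy).sub (hu' y hy))).congr_deriv (by ring)
  have hcont : ∀ {E D : ℝ → ℝ} {p q : ℝ}, 0 ≤ p →
      (∀ y ∈ Set.Ici (0 : ℝ), HasDerivWithinAt E (D y) (Set.Ici 0) y) →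
      ContinuousOn E (Set.Icc p q) := fun hp h y hy =>
    (h y (hp.trans hy.1)).continuousWithinAt.mono fun z hz => hp.trans hz.1
  have hder : ∀ {E D : ℝ → ℝ} {p q : ℝ}, 0 ≤ p →
      (∀ y ∈ Set.Ici (0 : ℝ), HasDerivWithinAt E (D y) (Set.Ici 0) y) →
      ∀ y ∈ Set.Ioo p q, HasDerivAt E (D y) y := fun hp h y hy =>
    (h y (hp.trans hy.1.le)).hasDerivAt (Ici_mem_nhds (hp.trans_lt hy.1))
  have hEuconst : ∀ y, N ≤ y → Eu y = Eu N := by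
    intro y hy
    refine le_antisymm ?_ ?_
    · have := add_const_le_exp_mul_of_deriv_le (K := 0) (c := 0) hy (hcont hN.le hdu)
        (hder hN.le hdu) fun z hz => by simp [hV z hz.1.le]
      simpa using this
    · have hdu_neg := fun z hz => (hdu z hz).neg
      have := add_const_le_exp_mul_of_deriv_le (K := 0) (c := 0) hy (hcont hN.le hdu_neg)
        (hder hN.le hdu_neg) fun z hz => by simp [hV z hz.1.le]
      simpa using this
  have hzero : ∀ y, 0 ≤ y → y ≤ N → Ew y ≤ 0 := by
    intro y hy hyN
    obtain ⟨B, hB⟩ := (isCompact_Icc (a := (0 : ℝ)) (b := N)).exists_bound_of_continuousOn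
      (hVc.mono fun z hz => hz.1)
    simp only [Real.norm_eq_abs] at hB
    have hB0 : 0 ≤ B := (abs_nonneg _).trans (hB 0 ⟨le_rfl, hN.le⟩)
    have := add_const_le_exp_mul_of_deriv_le (K := B * (1 + 1 / a)) (c := 0) hy
      (hcont le_rfl hdw) (hder le_rfl hdw) fun z hz => by
        have hWz : W (z - N) = 0 := hW0 _ fun h => by linarith [h.1, hz.2]
        have h1 := two_mul_mul_le_of_abs_le (hB z ⟨hz.1.le, hz.2.le.trans hyN⟩)
          (v z - u z) (v' z - u' z)
        have h2 := mul_le_mul_of_nonneg_left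
          (sq_add_sq_le_energy ha hξ.1 (v z - u z) (v' z - u' z)) hB0
        simp only [hWz, mul_zero, zero_mul, add_zero, mul_assoc] at h1 h2 ⊢
        exact h1.trans h2
    simpa [hEw, hu0, hv0, hu0', hv0'] using this
  have hbump : ∀ y, N ≤ y → y ≤ N + 1 → Ew y ≤ Real.exp K * (lam ^ 2 * Eu N) := by
    intro y hy hyN
    have hc0 : 0 ≤ lam ^ 2 * Eu N := mul_nonneg (sq_nonneg _) (hEu0 N)
    have h := add_const_le_exp_mul_of_deriv_le (K := K) (c := lam ^ 2 * Eu N) hy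
      (hcont hN.le hdw) (hder hN.le hdw) fun z hz => by
        have hWz := hM (z - N) ⟨by linarith [hz.1], by linarith [hz.2]⟩
        have hlW : |lam * W (z - N)| ≤ M := by
          rw [abs_mul]
          exact (mul_le_of_le_one_left (abs_nonneg _) hlam).trans hWz
        have h1 := two_mul_mul_le_of_abs_le hlW (v z - u z) (v' z - u' z)
        have h2 := two_mul_mul_le_of_abs_le hWz (lam * u z) (v' z - u' z)
        have h3 := sq_add_sq_le_energy ha hξ.1 (v z - u z) (v' z - u' z)
        have h4 := sq_add_sq_le_energy ha hξ.1 (u z) (u' z)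
        have h5 : lam ^ 2 * u z ^ 2 ≤ lam ^ 2 * ((1 + 1 / a) * Eu N) := by
          rw [← hEuconst z hz.1.le]
          exact mul_le_mul_of_nonneg_left (by linarith [sq_nonneg (u' z)]) (sq_nonneg _)
        have h6 : (v z - u z) ^ 2 + (v' z - u' z) ^ 2 +
            ((lam * u z) ^ 2 + (v' z - u' z) ^ 2) ≤
            2 * (1 + 1 / a) * (Ew z + lam ^ 2 * Eu N) := by
          have h7 : 0 ≤ (1 + 1 / a) * (lam ^ 2 * Eu N) := mul_nonneg ha'.le hc0
          simp only [hEw] at *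
          linarith [sq_nonneg (v z - u z)]
        have h8 := mul_le_mul_of_nonneg_left h6 hM0
        rw [hV z hz.1.le, hK]
        linarith
    have hE : Ew N ≤ 0 := hzero N hN.le le_rfl
    have h1 : Real.exp (K * (y - N)) ≤ Real.exp K :=
      Real.exp_le_exp.2 (mul_le_of_le_one_right (by positivity) (by linarith))
    calc Ew y ≤ Ew y + lam ^ 2 * Eu N := le_add_of_nonneg_right hc0
      _ ≤ Real.exp (K * (y - N)) * (Ew N + lam ^ 2 * Eu N) := h
      _ ≤ Real.exp (K * (y - N)) * (lam ^ 2 * Eu N) :=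
        mul_le_mul_of_nonneg_left (by linarith) (Real.exp_pos _).le
      _ ≤ _ := mul_le_mul_of_nonneg_right h1 hc0
  have hmain : Ew x ≤ Real.exp K * (lam ^ 2 * Eu x) := by
    rcases le_total x N with hxN | hxN
    · exact (hzero x hx hxN).trans
        (mul_nonneg (Real.exp_pos _).le (mul_nonneg (sq_nonneg _) (hEu0 x)))
    rw [hEuconst x hxN]
    rcases le_total x (N + 1) with hx1 | hx1
    · exact hbump x hxN hx1
    have hN1 : 0 ≤ N + 1 := by linarith
    have h := add_const_le_exp_mul_of_deriv_le (K := 0) (c := 0) hx1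
      (hcont hN1 hdw) (hder hN1 hdw) fun z hz => by
        have hWz : W (z - N) = 0 := hW0 _ fun h => by linarith [h.2, hz.1]
        simp [hWz, hV z (by linarith [hz.1])]
    exact (by simpa using h : Ew x ≤ Ew (N + 1)).trans (hbump _ (by linarith) le_rfl)
  have hEu_le : Eu x ≤ (1 + b) * (u x ^ 2 + u' x ^ 2) := by
    have h1 := mul_le_mul_of_nonneg_right hξ.2 (sq_nonneg (u x))
    have h2 : 0 ≤ b * u' x ^ 2 := mul_nonneg (by linarith) (sq_nonneg _)
    simp only [hEu]
    linarith [sq_nonneg (u x)]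
  rw [← Real.sqrt_sq_eq_abs, ← Real.sqrt_mul (by positivity), ← Real.sqrt_mul (by positivity)]
  refine Real.sqrt_le_sqrt ?_
  calc (v x - u x) ^ 2 + (v' x - u' x) ^ 2 ≤ (1 + 1 / a) * Ew x := sq_add_sq_le_energy ha hξ.1 _ _
    _ ≤ (1 + 1 / a) * (Real.exp K * (lam ^ 2 * ((1 + b) * (u x ^ 2 + u' x ^ 2)))) := by
      refine mul_le_mul_of_nonneg_left (hmain.trans ?_) ha'.le
      gcongr
    _ = _ := by ring
end
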